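/- arXiv:1809.04827 — 4 statements merged into one kernel-verified Lean document; each statement's English description precedes it below -/
import Mathlib

section
/- Let p be an odd prime, let q be a positive divisor of p−1, and let N_p denote the number of integers m with 1 ≤ m ≤ p−1, gcd(m, (p−1)/q) = 1, and m a QNRNP modulo p. Let β_0(p−1) denote the number of odd integers i with 1 ≤ i ≤ p−1 and gcd(i, p−1) > 1. Then |N_p − (q · φ((p−1)/q) · β_0(p−1))/(p−1)| ≤ 2^{ω((p−1)/q) + ω(p−1)} · (φ(p−1)/(p−1)) · √p · log p. -/
/-- An integer `g` is a primitive root modulo `p`: its residue class generates the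
multiplicative group of `ℤ/pℤ`, i.e. every nonzero residue is a power of `g`. -/
def IsPrimitiveRootModP (p : ℕ) (g : ℤ) : Prop :=
  ∀ a : ZMod p, a ≠ 0 → ∃ k : ℕ, (g : ZMod p) ^ k = a

/-- `g` is a quadratic non-residue modulo `p` which is not a primitive root modulo `p`. -/
def IsQNRNP (p : ℕ) (g : ℤ) : Prop :=
  (¬ ∃ x : ℤ, x ^ 2 ≡ g [ZMOD p]) ∧ ¬ IsPrimitiveRootModP p g

section

open Finset

theorem norm_gaussSum_eq_sqrt {F : Type*} [Field F] [Fintype F] {χ : MulChar F ℂ} (hχ : χ ≠ 1)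
    {ψ : AddChar F ℂ} (hψ : ψ.IsPrimitive) : ‖gaussSum χ ψ‖ = √(Fintype.card F) := by
  rw [eq_comm, Real.sqrt_eq_iff_mul_self_eq (by positivity) (norm_nonneg _)]
  have h := gaussSum_mul_gaussSum_eq_card hχ hψ
  rw [← star_gaussSum_eq] at h
  have h2 := congrArg norm h
  rw [norm_mul, norm_star, Complex.norm_natCast] at h2
  exact h2.symm

theorem sum_mulChar_mul_gaussSum {F : Type*} [Field F] [Fintype F] {χ : MulChar F ℂ}
    (hχ : χ ≠ 1) (ψ : AddChar F ℂ) {ι : Type*} (s : Finset ι) (f : ι → F) :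
    (∑ n ∈ s, χ (f n)) * gaussSum χ⁻¹ ψ = ∑ a, χ⁻¹ a * ∑ n ∈ s, ψ (a * f n) := by
  have key (b : F) : χ b * gaussSum χ⁻¹ ψ = ∑ a, χ⁻¹ a * ψ (a * b) := by
    rcases eq_or_ne b 0 with rfl | hb
    · simp [MulChar.sum_eq_zero_of_ne_one (inv_ne_one.mpr hχ), MulChar.map_nonunit χ not_isUnit_zero]
    · have := gaussSum_mulShift_eq χ⁻¹ ψ (Units.mk0 b hb)
      rw [inv_inv, Units.val_mk0] at this
      rw [← this]
      simp [gaussSum, AddChar.mulShift_apply, mul_comm b]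
  simp_rw [sum_mul, key, mul_sum]
  exact sum_comm

theorem norm_geom_sum_exp_le {x : ℝ} (hx : 0 < Real.sin x) (N : ℕ) :
    ‖∑ n ∈ Ico 1 (N + 1), Complex.exp (Complex.I * (2 * x : ℝ)) ^ n‖ ≤ 1 / Real.sin x := by
  set z := Complex.exp (Complex.I * (2 * x : ℝ)) with hz
  have h1 : ‖z - 1‖ = 2 * Real.sin x := by
    rw [hz, Complex.norm_exp_I_mul_ofReal_sub_one]
    simp [abs_of_pos hx]
  have hz1 : ‖z‖ = 1 := by
    rw [hz, mul_comm]; exact Complex.norm_exp_ofReal_mul_I _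
  have hne : z ≠ 1 := fun h ↦ by rw [h] at h1; simp at h1; exact hx.ne' h1
  rw [geom_sum_Ico hne (by lia), norm_div, h1, div_le_div_iff₀ (by positivity) hx]
  have : ‖z ^ (N + 1) - z ^ 1‖ ≤ 2 := by
    refine (norm_sub_le _ _).trans ?_
    simp [norm_pow, hz1]; norm_num
  nlinarith

theorem sum_one_div_sin_eq (K : ℕ) :
    ∑ v ∈ Ico 1 (2 * K + 1), 1 / Real.sin (Real.pi * v / (2 * K + 1 : ℕ)) =
      2 * ∑ v ∈ Ico 1 (K + 1), 1 / Real.sin (Real.pi * v / (2 * K + 1 : ℕ)) := by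
  have hsplit := sum_Ico_consecutive
    (fun v : ℕ ↦ 1 / Real.sin (Real.pi * v / (2 * K + 1 : ℕ)))
    (show 1 ≤ K + 1 by lia) (show K + 1 ≤ 2 * K + 1 by lia)
  have h := sum_Ico_reflect (fun v : ℕ ↦ 1 / Real.sin (Real.pi * v / (2 * K + 1 : ℕ))) 1
    (show K + 1 ≤ 2 * K + 1 + 1 by lia)
  rw [show 2 * K + 1 + 1 - (K + 1) = K + 1 by lia, show 2 * K + 1 + 1 - 1 = 2 * K + 1 by lia] at h
  rw [← hsplit, ← h, two_mul (∑ _ ∈ _, _), add_right_inj]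
  refine sum_congr rfl fun v hv ↦ ?_
  rw [mem_Ico] at hv
  rw [Nat.cast_sub (by lia), mul_sub, sub_div, mul_div_cancel_right₀ _ (by positivity),
    Real.sin_pi_sub]

theorem sum_one_div_le_log (K : ℕ) :
    ∑ v ∈ Ico 1 (K + 1), (1 / v : ℝ) ≤ Real.log (2 * K + 1 : ℕ) := by
  induction K with
  | zero => simp
  | succ K ih =>
    rw [sum_Ico_succ_top (by lia)]
    have h := Real.le_log_one_add_of_nonneg (x := 2 / (2 * K + 1)) (by positivity)
    have h1 : 2 * (2 / (2 * K + 1 : ℝ)) / (2 / (2 * K + 1) + 2) = 1 / (K + 1 : ℕ) := by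
      push_cast; field_simp; ring
    have h2 : Real.log (2 * (K + 1) + 1 : ℕ) =
        Real.log (2 * K + 1 : ℕ) + Real.log (1 + 2 / (2 * K + 1)) := by
      rw [← Real.log_mul (by positivity) (by positivity)]
      congr 1; push_cast; field_simp; ring
    rw [h2, ← h1]
    exact add_le_add ih h

theorem log_le_sum_one_div (L : ℕ) :
    Real.log (L + 1 : ℕ) ≤ ∑ v ∈ Ico 1 (L + 1), (1 / v : ℝ) := by
  induction L with
  | zero => simp
  | succ L ih =>
    rw [sum_Ico_succ_top (by lia)]
    have h := Real.log_le_sub_one_of_pos (x := 1 + 1 / (L + 1 : ℕ)) (by positivity)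
    have h2 : Real.log (L + 1 + 1 : ℕ) =
        Real.log (L + 1 : ℕ) + Real.log (1 + 1 / (L + 1 : ℕ)) := by
      rw [← Real.log_mul (by positivity) (by positivity)]
      congr 1; push_cast; field_simp
    rw [h2]
    linarith

theorem two_mul_le_sin_pi_mul {x : ℝ} (h0 : 0 ≤ x) (h1 : x ≤ 1 / 2) :
    2 * x ≤ Real.sin (Real.pi * x) := by
  have hpi := Real.pi_pos
  have := Real.mul_le_sin (x := Real.pi * x) (by positivity) (by nlinarith)
  convert this using 1
  field_simp

theorem five_halves_mul_le_sin_pi_mul {x : ℝ} (h0 : 0 ≤ x) (h1 : x ≤ 1 / 6) :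
    5 / 2 * x ≤ Real.sin (Real.pi * x) := by
  rcases h0.eq_or_lt with rfl | h0
  · simp
  have h3 := Real.pi_gt_three
  have h4 := Real.pi_lt_d2
  have hy : Real.pi * x ≤ 11 / 20 := by nlinarith
  have := Real.sin_gt_sub_cube (x := Real.pi * x) (by positivity)
  have h5 : 3 * x ≤ Real.pi * x := by nlinarith
  have h6 : (Real.pi * x) ^ 2 ≤ (11 / 20) ^ 2 := by gcongr
  nlinarith [mul_le_mul_of_nonneg_left h6 (show 0 ≤ Real.pi * x by positivity)]

theorem sum_one_div_sin_le (K : ℕ) :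
    ∑ v ∈ Ico 1 (K + 1), 1 / Real.sin (Real.pi * v / (2 * K + 1 : ℕ)) ≤
      (2 * K + 1 : ℕ) / 2 * Real.log (2 * K + 1 : ℕ) := by
  refine le_trans ?_ (mul_le_mul_of_nonneg_left (sum_one_div_le_log K) (by positivity))
  rw [mul_sum]
  refine sum_le_sum fun v hv ↦ ?_
  rw [mem_Ico] at hv
  have hv0 : (0 : ℝ) < v := by exact_mod_cast hv.1
  have hvK : (v : ℝ) ≤ K := by exact_mod_cast Nat.lt_succ_iff.mp hv.2
  have h := two_mul_le_sin_pi_mul (x := v / (2 * K + 1 : ℕ)) (by positivity)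
    (by rw [div_le_div_iff₀ (by positivity) (by positivity)]; push_cast; linarith)
  rw [mul_div_assoc]
  refine (one_div_le_one_div_of_le (by positivity) h).trans (le_of_eq ?_)
  field_simp

theorem sum_one_div_sin_le_of_large (K : ℕ) (hK : 36 ≤ 2 * K + 1) :
    ∑ v ∈ Ico 1 (K + 1), 1 / Real.sin (Real.pi * v / (2 * K + 1 : ℕ)) ≤
      (2 * K + 1 : ℕ) / 2 * (9 / 10 * Real.log (2 * K + 1 : ℕ)) := by
  set p := 2 * K + 1 with hp
  set L := p / 6 with hL
  have hp0 : (0 : ℝ) < p := by positivity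
  have hlog : (1 / 2) * Real.log p ≤ Real.log (L + 1 : ℕ) := by
    have h6 : (p : ℝ) ≤ 6 * (L + 1 : ℕ) := by exact_mod_cast (by lia)
    have h7 : (6 : ℝ) ≤ (L + 1 : ℕ) := by exact_mod_cast (by lia)
    have := Real.log_le_log hp0 (h6.trans (mul_le_mul_of_nonneg_right h7 (by positivity)))
    rw [Real.log_mul (by positivity) (by positivity)] at this
    linarith
  have hbound : 9 / 10 * Real.log p ≥
      ∑ v ∈ Ico 1 (K + 1), (1 / v : ℝ) - 1 / 5 * ∑ v ∈ Ico 1 (L + 1), (1 / v : ℝ) := by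
    have := sum_one_div_le_log K
    have := log_le_sum_one_div L
    linarith
  refine le_trans ?_ (mul_le_mul_of_nonneg_left hbound (by positivity))
  rw [← sum_Ico_consecutive _ (show 1 ≤ L + 1 by lia) (show L + 1 ≤ K + 1 by lia),
    ← sum_Ico_consecutive (fun v : ℕ ↦ (1 / v : ℝ)) (show 1 ≤ L + 1 by lia)
      (show L + 1 ≤ K + 1 by lia),
    show ∀ a b : ℝ, a + b - 1 / 5 * a = 4 / 5 * a + b by intros; ring, mul_add, mul_sum, mul_sum,
    mul_sum]
  refine add_le_add (sum_le_sum fun v hv ↦ ?_) (sum_le_sum fun v hv ↦ ?_) <;> rw [mem_Ico] at hv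
  · have hv0 : (0 : ℝ) < v := by exact_mod_cast hv.1
    have hvL : (6 * v : ℝ) ≤ p := by exact_mod_cast (by lia)
    have h := five_halves_mul_le_sin_pi_mul (x := v / p) (by positivity)
      (by rw [div_le_div_iff₀ (by positivity) (by positivity)]; linarith)
    rw [mul_div_assoc]
    refine (one_div_le_one_div_of_le (by positivity) h).trans (le_of_eq ?_)
    field_simp
    norm_num
  · have hv0 : (0 : ℝ) < v := by exact_mod_cast (by lia)
    have hvK : (2 * v : ℝ) ≤ p := by exact_mod_cast (by lia)
    have h := two_mul_le_sin_pi_mul (x := v / p) (by positivity)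
      (by rw [div_le_div_iff₀ (by positivity) (by positivity)]; linarith)
    rw [mul_div_assoc]
    refine (one_div_le_one_div_of_le (by positivity) h).trans (le_of_eq ?_)
    field_simp

theorem norm_sum_mulChar_le {p : ℕ} [Fact p.Prime] (hp2 : p ≠ 2) {χ : MulChar (ZMod p) ℂ}
    (hχ : χ ≠ 1) (N : ℕ) {B : ℝ}
    (hB : ∑ v ∈ Ico 1 ((p - 1) / 2 + 1), 1 / Real.sin (Real.pi * v / p) ≤ p / 2 * B) :
    ‖∑ n ∈ Ico 1 (N + 1), χ (n : ZMod p)‖ ≤ √p * B := by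
  have hpp : p.Prime := Fact.out
  obtain ⟨K, hK⟩ := hpp.odd_of_ne_two hp2
  have hp0 : (0 : ℝ) < p := by exact_mod_cast hpp.pos
  have hinner (a : ZMod p) (ha : a ≠ 0) :
      ‖∑ n ∈ Ico 1 (N + 1), ZMod.stdAddChar (a * (n : ZMod p))‖ ≤
        1 / Real.sin (Real.pi * a.val / p) := by
    have hpos : 0 < a.val := Nat.pos_of_ne_zero (by simpa using ha)
    have hlt : (a.val : ℝ) < p := by exact_mod_cast ZMod.val_lt a
    have hsin : 0 < Real.sin (Real.pi * a.val / p) := by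
      refine Real.sin_pos_of_pos_of_lt_pi (by positivity) ?_
      rw [div_lt_iff₀ hp0]
      exact mul_lt_mul_of_pos_left hlt Real.pi_pos
    refine le_of_eq_of_le (congrArg norm (sum_congr rfl fun n _ ↦ ?_)) (norm_geom_sum_exp_le hsin N)
    rw [← nsmul_eq_mul', AddChar.map_nsmul_eq_pow, ZMod.stdAddChar_apply, ZMod.toCircle_apply]
    congr 2
    push_cast
    ring
  have hsum : ∑ a : ZMod p, ‖χ⁻¹ a * ∑ n ∈ Ico 1 (N + 1), ZMod.stdAddChar (a * (n : ZMod p))‖ ≤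
      p * B := by
    calc _ ≤ ∑ a : ZMod p, (fun v : ℕ ↦ 1 / Real.sin (Real.pi * v / p)) a.val := by
          refine sum_le_sum fun a _ ↦ ?_
          rcases eq_or_ne a 0 with rfl | ha
          · simp [MulChar.map_nonunit χ⁻¹ not_isUnit_zero]
          · rw [norm_mul]
            refine (mul_le_of_le_one_left (norm_nonneg _) ?_).trans (hinner a ha)
            exact DirichletCharacter.norm_le_one χ⁻¹ a
      _ = ∑ v ∈ range p, 1 / Real.sin (Real.pi * v / p) := by
          refine sum_bij (fun a _ ↦ a.val) (fun a _ ↦ mem_range.mpr (ZMod.val_lt a))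
            (fun a _ b _ h ↦ ZMod.val_injective p h)
            (fun v hv ↦ ⟨(v : ZMod p), mem_univ _, ZMod.val_cast_of_lt (mem_range.mp hv)⟩)
            (fun _ _ ↦ rfl)
      _ = ∑ v ∈ Ico 1 p, 1 / Real.sin (Real.pi * v / p) := by
          rw [range_eq_Ico, sum_eq_sum_Ico_succ_bot hpp.pos]
          simp
      _ = 2 * ∑ v ∈ Ico 1 ((p - 1) / 2 + 1), 1 / Real.sin (Real.pi * v / p) := by
          have := sum_one_div_sin_eq K
          rwa [← hK, show K = (p - 1) / 2 by lia] at this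
      _ ≤ p * B := by linarith
  have hmain : ‖∑ n ∈ Ico 1 (N + 1), χ (n : ZMod p)‖ * √p ≤ √p * B * √p := by
    have h := congrArg norm
      (sum_mulChar_mul_gaussSum hχ ZMod.stdAddChar (Ico 1 (N + 1)) (fun n ↦ (n : ZMod p)))
    rw [norm_mul, norm_gaussSum_eq_sqrt (inv_ne_one.mpr hχ) (ZMod.isPrimitive_stdAddChar p),
      ZMod.card] at h
    rw [h, mul_right_comm, Real.mul_self_sqrt hp0.le]
    exact (norm_sum_le _ _).trans hsum
  exact le_of_mul_le_mul_right hmain (Real.sqrt_pos.mpr hp0)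

theorem indicator_coprime_eq_sum {M : ℕ} (hM : M ≠ 0) (m : ℕ) :
    (if Nat.gcd m M = 1 then 1 else 0 : ℂ) =
      ∑ t ∈ M.primeFactors.powerset, (-1) ^ #t * (if (∏ r ∈ t, r) ∣ m then 1 else 0) := by
  have h := prod_one_add (f := fun r ↦ -(if r ∣ m then 1 else 0 : ℂ)) M.primeFactors
  have hterm : ∀ t ∈ M.primeFactors.powerset, ∏ r ∈ t, -(if r ∣ m then 1 else 0 : ℂ) =
      (-1) ^ #t * (if (∏ r ∈ t, r) ∣ m then 1 else 0) := by
    intro t ht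
    rw [mem_powerset] at ht
    rw [prod_neg, prod_ite_zero, prod_const_one]
    congr 2
    refine propext ⟨fun h ↦ ?_, fun h r hr ↦ (dvd_prod_of_mem _ hr).trans h⟩
    exact prod_primes_dvd m (fun r hr ↦ (Nat.prime_of_mem_primeFactors (ht hr)).prime) h
  rw [sum_congr rfl hterm] at h
  rw [← h]
  split_ifs with hc
  · refine (prod_eq_one fun r hr ↦ ?_).symm
    rw [if_neg, neg_zero, add_zero]
    intro hrm
    have := Nat.dvd_gcd hrm (Nat.dvd_of_mem_primeFactors hr)
    rw [hc] at this
    exact (Nat.prime_of_mem_primeFactors hr).not_dvd_one this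
  · obtain ⟨r, hr, hrd⟩ := Nat.exists_prime_and_dvd hc
    refine (prod_eq_zero (Nat.mem_primeFactors.mpr
      ⟨hr, hrd.trans (Nat.gcd_dvd_right _ _), hM⟩) ?_).symm
    rw [if_pos (hrd.trans (Nat.gcd_dvd_left _ _))]
    ring

theorem sum_filter_dvd_Ico {A : Type*} [AddCommMonoid A] (f : ℕ → A) {d : ℕ} (hd : 0 < d) (N : ℕ) :
    ∑ m ∈ Ico 1 (N + 1) with d ∣ m, f m = ∑ k ∈ Ico 1 (N / d + 1), f (d * k) := by
  symm
  refine sum_bij (fun k _ ↦ d * k) (fun k hk ↦ ?_) (fun _ _ _ _ h ↦ Nat.eq_of_mul_eq_mul_left hd h)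
    (fun m hm ↦ ?_) (fun _ _ ↦ rfl)
  · rw [mem_Ico, Nat.lt_succ_iff, Nat.le_div_iff_mul_le hd] at hk
    rw [mem_filter, mem_Ico]
    exact ⟨⟨Nat.mul_pos hd hk.1, by lia⟩, dvd_mul_right _ _⟩
  · rw [mem_filter, mem_Ico] at hm
    obtain ⟨⟨h1, h2⟩, k, rfl⟩ := hm
    refine ⟨k, ?_, rfl⟩
    rw [mem_Ico, Nat.lt_succ_iff, Nat.le_div_iff_mul_le hd]
    exact ⟨Nat.pos_of_mul_pos_left h1, by lia⟩

theorem norm_sum_mulChar_coprime_le {p : ℕ} [Fact p.Prime] (χ : MulChar (ZMod p) ℂ) {P : ℝ}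
    (hP : ∀ N : ℕ, ‖∑ n ∈ Ico 1 (N + 1), χ (n : ZMod p)‖ ≤ P) {M : ℕ} (hM : M ≠ 0) (N : ℕ) :
    ‖∑ m ∈ Ico 1 (N + 1) with Nat.gcd m M = 1, χ (m : ZMod p)‖ ≤ 2 ^ #M.primeFactors * P := by
  have h : ∑ m ∈ Ico 1 (N + 1) with Nat.gcd m M = 1, χ (m : ZMod p) =
      ∑ t ∈ M.primeFactors.powerset, (-1) ^ #t * (χ ((∏ r ∈ t, r : ℕ) : ZMod p) *
        ∑ k ∈ Ico 1 (N / (∏ r ∈ t, r) + 1), χ (k : ZMod p)) := by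
    calc _ = ∑ m ∈ Ico 1 (N + 1), ∑ t ∈ M.primeFactors.powerset,
          (-1) ^ #t * (if (∏ r ∈ t, r) ∣ m then 1 else 0) * χ (m : ZMod p) := by
          rw [sum_filter]
          refine sum_congr rfl fun m _ ↦ ?_
          rw [← sum_mul, ← indicator_coprime_eq_sum hM]
          simp
      _ = _ := by
          rw [sum_comm]
          refine sum_congr rfl fun t ht ↦ ?_
          rw [mem_powerset] at ht
          have hd : 0 < ∏ r ∈ t, r := prod_pos fun r hr ↦ Nat.pos_of_mem_primeFactors (ht hr)
          have := sum_filter_dvd_Ico (fun m : ℕ ↦ χ (m : ZMod p)) hd N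
          simp_rw [Nat.cast_mul, map_mul, ← mul_sum] at this
          rw [← this, sum_filter, mul_sum]
          refine sum_congr rfl fun m _ ↦ ?_
          split_ifs <;> simp
  rw [h]
  refine (norm_sum_le _ _).trans ?_
  refine (sum_le_card_nsmul _ _ P fun t _ ↦ ?_).trans (by simp [card_powerset])
  rw [norm_mul, norm_pow, norm_neg, norm_one, one_pow, one_mul, norm_mul]
  exact (mul_le_of_le_one_left (norm_nonneg _) (DirichletCharacter.norm_le_one χ _)).trans (hP _)

theorem card_filter_coprime_Ico_mul (M q : ℕ) :
    #{m ∈ Ico 1 (q * M + 1) | Nat.gcd m M = 1} = q * M.totient := by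
  induction q with
  | zero => simp
  | succ q ih =>
    rw [← Ico_union_Ico_eq_Ico (show 1 ≤ q * M + 1 by lia)
      (show q * M + 1 ≤ (q + 1) * M + 1 by nlinarith), filter_union, card_union_of_disjoint, ih,
      add_mul q 1, one_mul]
    · have := Nat.filter_coprime_Ico_eq_totient M (q * M + 1)
      simp only [Nat.coprime_comm (n := M), Nat.coprime_iff_gcd_eq_one] at this
      rw [add_right_comm, this, add_one_mul]
    · exact disjoint_filter_filter (Ico_disjoint_Ico_consecutive _ _ _)

theorem one_div_card_add_one_le_prod (s : Finset ℕ) (hs : ∀ r ∈ s, 2 ≤ r) :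
    1 / (#s + 1 : ℝ) ≤ ∏ r ∈ s, (1 - (r : ℝ)⁻¹) := by
  induction s using Finset.induction_on_max with
  | empty => simp
  | insert a s hmax ih =>
    have ha : a ∉ s := fun h ↦ (hmax a h).false
    have hcard : #s + 2 ≤ a := by
      have hsub : s ⊆ Ico 2 a := fun r hr ↦
        mem_Ico.mpr ⟨hs r (mem_insert_of_mem hr), hmax r hr⟩
      have := card_le_card hsub
      have := hs a (mem_insert_self _ _)
      rw [Nat.card_Ico] at *
      lia
    rw [prod_insert ha, card_insert_of_notMem ha]
    have h1 := ih fun r hr ↦ hs r (mem_insert_of_mem hr)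
    have hc : (#s + 2 : ℝ) ≤ a := by exact_mod_cast hcard
    have h2 : 1 - (#s + 2 : ℝ)⁻¹ ≤ 1 - (a : ℝ)⁻¹ := by gcongr
    have h3 : (0 : ℝ) ≤ 1 - (#s + 2 : ℝ)⁻¹ := by
      rw [sub_nonneg]; exact inv_le_one_of_one_le₀ (by linarith [(Nat.cast_nonneg #s : (0:ℝ) ≤ _)])
    refine le_trans (le_of_eq ?_) (mul_le_mul h2 h1 (by positivity) (h3.trans h2))
    push_cast
    field_simp
    ring

theorem totient_div_eq_prod {n : ℕ} (hn : n ≠ 0) :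
    (n.totient : ℝ) / n = ∏ r ∈ n.primeFactors, (1 - (r : ℝ)⁻¹) := by
  have := congrArg (Rat.cast : ℚ → ℝ) (Nat.totient_eq_mul_prod_factors n)
  push_cast at this
  rw [this]
  field_simp

/-- `f` lies in `B` times the absolutely convex hull of the multiplicative characters, expressed
through linear functionals. -/
def IsCharBounded {F : Type*} [Field F] (f : F → ℂ) (B : ℝ) : Prop :=
  ∀ (T : (F → ℂ) →ₗ[ℂ] ℂ) (P : ℝ), (∀ χ : MulChar F ℂ, ‖T χ‖ ≤ P) → ‖T f‖ ≤ B * P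

namespace IsCharBounded

variable {F : Type*} [Field F] {f g : F → ℂ} {B C : ℝ}

theorem mulChar (χ : MulChar F ℂ) : IsCharBounded χ 1 := fun T P h ↦ by simpa using h χ

theorem add (hf : IsCharBounded f B) (hg : IsCharBounded g C) : IsCharBounded (f + g) (B + C) := by
  intro T P h
  rw [map_add, add_mul]
  exact (norm_add_le _ _).trans (add_le_add (hf T P h) (hg T P h))

theorem smul (hf : IsCharBounded f B) (a : ℂ) : IsCharBounded (a • f) (‖a‖ * B) := by
  intro T P h
  rw [map_smul, smul_eq_mul, norm_mul, mul_assoc]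
  exact mul_le_mul_of_nonneg_left (hf T P h) (norm_nonneg _)

theorem sum {ι : Type*} {s : Finset ι} {f : ι → F → ℂ} {B : ι → ℝ}
    (h : ∀ i ∈ s, IsCharBounded (f i) (B i)) : IsCharBounded (∑ i ∈ s, f i) (∑ i ∈ s, B i) := by
  intro T P hT
  rw [map_sum, sum_mul]
  exact norm_sum_le_of_le _ fun i hi ↦ h i hi T P hT

theorem mulChar_mul (hf : IsCharBounded f B) (χ : MulChar F ℂ) :
    IsCharBounded ((χ : F → ℂ) * f) B := by
  intro T P h
  refine hf (T ∘ₗ LinearMap.mulLeft ℂ (χ : F → ℂ)) P fun ψ ↦ ?_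
  have : (χ : F → ℂ) * ψ = (χ * ψ : MulChar F ℂ) := by ext; simp
  rw [LinearMap.comp_apply, LinearMap.mulLeft_apply, this]
  exact h (χ * ψ)

end IsCharBounded

open Classical in
/-- The indicator of the nonzero elements at which none of the characters `χ r`, `r ∈ s`,
takes the value `1`. -/
noncomputable def sieveIndicator {F : Type*} [Field F] (χ : ℕ → MulChar F ℂ) (s : Finset ℕ) :
    F → ℂ := fun x ↦ if x ≠ 0 ∧ ∀ r ∈ s, χ r x ≠ 1 then 1 else 0

theorem sieveIndicator_empty {F : Type*} [Field F] (χ : ℕ → MulChar F ℂ) :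
    sieveIndicator χ ∅ = (1 : MulChar F ℂ) := by
  ext x
  by_cases hx : x = 0
  · simp [sieveIndicator, hx, MulChar.map_nonunit (1 : MulChar F ℂ) not_isUnit_zero]
  · simp [sieveIndicator, hx, MulChar.one_apply (Ne.isUnit hx)]

theorem sieveIndicator_insert {F : Type*} [Field F] {χ : ℕ → MulChar F ℂ} {s : Finset ℕ} {r : ℕ}
    (hr : 2 ≤ r) (hχ : χ r ^ r = 1) : sieveIndicator χ (insert r s) =
      (1 - (r : ℂ)⁻¹) • sieveIndicator χ s -
        (r : ℂ)⁻¹ • ∑ j ∈ Ico 1 r, ((χ r ^ j : MulChar F ℂ) : F → ℂ) * sieveIndicator χ s := by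
  have hr0 : (r : ℂ) ≠ 0 := by exact_mod_cast (by lia : r ≠ 0)
  ext x
  have hins : sieveIndicator χ (insert r s) x =
      if χ r x = 1 then 0 else sieveIndicator χ s x := by
    have hiff : (∀ a ∈ insert r s, χ a x ≠ 1) ↔ χ r x ≠ 1 ∧ ∀ a ∈ s, χ a x ≠ 1 :=
      forall_mem_insert _ _ _
    by_cases h1 : χ r x = 1
    · rw [if_pos h1, sieveIndicator, if_neg fun h ↦ (hiff.mp h.2).1 h1]
    · rw [if_neg h1, sieveIndicator, sieveIndicator]
      congr 1
      exact propext (and_congr_right fun _ ↦ hiff.trans (and_iff_right h1))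
  rw [hins]
  simp only [Pi.sub_apply, Pi.smul_apply, Finset.sum_apply, Pi.mul_apply, smul_eq_mul, ← sum_mul]
  by_cases hx : x = 0
  · simp [sieveIndicator, hx]
  have hpow : ∀ j ∈ Ico 1 r, (χ r ^ j) x = χ r x ^ j := fun j hj ↦
    MulChar.pow_apply' _ (by rw [mem_Ico] at hj; lia) _
  rw [sum_congr rfl hpow]
  by_cases h1 : χ r x = 1
  · simp only [h1, one_pow, sum_const, Nat.card_Ico, if_true, nsmul_eq_mul,
      Nat.cast_sub (show 1 ≤ r by lia), Nat.cast_one]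
    field_simp
    ring
  · have hxr : χ r x ^ r = 1 := by
      rw [← MulChar.pow_apply' _ (by lia), hχ, MulChar.one_apply (Ne.isUnit hx)]
    rw [if_neg h1, geom_sum_Ico h1 (show 1 ≤ r by lia), hxr, pow_one,
      show (1 - χ r x) / (χ r x - 1) = -1 by
        rw [← neg_sub, neg_div, div_self (sub_ne_zero.mpr h1)]]
    ring

theorem isCharBounded_sieveIndicator_sub {F : Type*} [Field F] {χ : ℕ → MulChar F ℂ} {s : Finset ℕ}
    (hs : ∀ r ∈ s, 2 ≤ r ∧ χ r ^ r = 1) :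
    IsCharBounded (sieveIndicator χ s -
        ((∏ r ∈ s, (1 - (r : ℝ)⁻¹) : ℝ) : ℂ) • ((1 : MulChar F ℂ) : F → ℂ))
      ((2 ^ #s - 1) * ∏ r ∈ s, (1 - (r : ℝ)⁻¹)) := by
  induction s using Finset.induction_on with
  | empty =>
    intro T P _
    simp [sieveIndicator_empty]
  | insert r s hrs ih =>
    have ih := ih fun r hr ↦ hs r (mem_insert_of_mem hr)
    obtain ⟨hr2, hχ⟩ := hs r (mem_insert_self _ _)
    rw [sieveIndicator_insert hr2 hχ, prod_insert hrs, card_insert_of_notMem hrs]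
    have hκ : 0 ≤ ∏ r ∈ s, (1 - (r : ℝ)⁻¹) := le_trans (by positivity)
      (one_div_card_add_one_le_prod s fun r hr ↦ (hs r (mem_insert_of_mem hr)).1)
    set κ := ∏ r ∈ s, (1 - (r : ℝ)⁻¹)
    set D := sieveIndicator χ s
    have h2 : (2 : ℝ) ≤ r := by exact_mod_cast hr2
    have hr1 : (0 : ℝ) ≤ 1 - (r : ℝ)⁻¹ := by
      rw [sub_nonneg]; exact inv_le_one_of_one_le₀ (by linarith)
    have hA := ih.smul ((1 - (r : ℝ)⁻¹ : ℝ) : ℂ)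
    have hB := (IsCharBounded.sum (s := Ico 1 r) fun j _ ↦ ih.mulChar_mul (χ r ^ j)).smul
      (-(r : ℂ)⁻¹)
    have hC := (IsCharBounded.sum (s := Ico 1 r) fun j _ ↦
      IsCharBounded.mulChar (χ r ^ j)).smul (-((r : ℂ)⁻¹ * κ))
    convert (hA.add hB).add hC using 1
    · ext x
      have hone : ∀ j, (χ r ^ j) x * (1 : MulChar F ℂ) x = (χ r ^ j) x := fun j ↦ by
        rw [← MulChar.mul_apply, mul_one]
      simp only [Pi.sub_apply, Pi.add_apply, Pi.smul_apply, Finset.sum_apply, Pi.mul_apply,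
        smul_eq_mul, mul_sub, sum_sub_distrib, ← mul_assoc, mul_right_comm _ (κ : ℂ), hone]
      simp only [← sum_mul]
      push_cast
      ring
    · rw [Complex.norm_real, Real.norm_of_nonneg hr1]
      simp [abs_of_nonneg hκ, Nat.cast_sub (show 1 ≤ r by lia)]
      field_simp
      ring

theorem mulChar_pow_generator_eq_one_iff {F : Type*} [Field F] {χ : MulChar F ℂ} {g : Fˣ}
    (hg : ∀ x, x ∈ Subgroup.zpowers g) (i : ℕ) : χ ((g ^ i : Fˣ) : F) = 1 ↔ orderOf χ ∣ i := by
  rw [orderOf_dvd_iff_pow_eq_one, MulChar.eq_iff hg, MulChar.one_apply_coe,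
    MulChar.pow_apply_coe, Units.val_pow_eq_pow_val, map_pow]

theorem isPrimitiveRootModP_iff_coprime {p : ℕ} [Fact p.Prime] {g : (ZMod p)ˣ}
    (hg : ∀ x, x ∈ Subgroup.zpowers g) {m : ℤ} {i : ℕ} (hm : (m : ZMod p) = (g ^ i : (ZMod p)ˣ)) :
    IsPrimitiveRootModP p m ↔ i.gcd (p - 1) = 1 := by
  have hord : orderOf g = p - 1 := by
    rw [orderOf_eq_card_of_forall_mem_zpowers hg, Nat.card_eq_fintype_card, ZMod.card_units]
  unfold IsPrimitiveRootModP
  rw [hm]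
  constructor
  · intro h
    obtain ⟨k, hk⟩ := h g g.ne_zero
    rw [← Units.val_pow_eq_pow_val, Units.val_inj, ← pow_mul] at hk
    nth_rewrite 2 [← pow_one g] at hk
    rw [pow_eq_pow_iff_modEq, hord] at hk
    refine Nat.dvd_one.mp ?_
    have h1 := hk.of_dvd (Nat.gcd_dvd_right i (p - 1))
    have h2 : i.gcd (p - 1) ∣ i * k := (Nat.gcd_dvd_left i (p - 1)).mul_right k
    exact (Nat.ModEq.dvd_iff h1 dvd_rfl).mp h2
  · intro h a ha
    obtain ⟨k, hk⟩ := (mem_powers_iff_mem_zpowers.mpr (hg (Units.mk0 a ha)))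
    obtain ⟨j, hj⟩ := exists_pow_eq_self_of_coprime (x := g) (n := i) (by rwa [hord])
    refine ⟨j * k, ?_⟩
    rw [← Units.val_pow_eq_pow_val, pow_mul, hj]
    simpa using congrArg Units.val hk

theorem exists_sq_modEq_iff_even {p : ℕ} [Fact p.Prime] (hp2 : p ≠ 2) {g : (ZMod p)ˣ}
    (hg : ∀ x, x ∈ Subgroup.zpowers g) {m : ℤ} {i : ℕ} (hm : (m : ZMod p) = (g ^ i : (ZMod p)ˣ)) :
    (∃ x : ℤ, x ^ 2 ≡ m [ZMOD p]) ↔ Even i := by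
  have hpp : p.Prime := Fact.out
  have hord : orderOf g = p - 1 := by
    rw [orderOf_eq_card_of_forall_mem_zpowers hg, Nat.card_eq_fintype_card, ZMod.card_units]
  have hev : 2 ∣ p - 1 := (hpp.even_sub_one hp2).two_dvd
  simp_rw [← ZMod.intCast_eq_intCast_iff, hm]
  push_cast
  constructor
  · rintro ⟨x, hx⟩
    have hx0 : (x : ZMod p) ≠ 0 := fun h ↦ by
      rw [h, zero_pow two_ne_zero] at hx
      exact (pow_ne_zero i g.ne_zero) hx.symm
    obtain ⟨k, hk⟩ := (mem_powers_iff_mem_zpowers.mpr (hg (Units.mk0 _ hx0)))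
    have hk' : ((g ^ k : (ZMod p)ˣ) : ZMod p) = x := congrArg Units.val hk
    rw [← hk', ← Units.val_pow_eq_pow_val, ← Units.val_pow_eq_pow_val, Units.val_inj, ← pow_mul,
      pow_eq_pow_iff_modEq, hord] at hx
    have h1 := hx.of_dvd hev
    exact even_iff_two_dvd.mpr ((Nat.ModEq.dvd_iff h1 dvd_rfl).mp (dvd_mul_left 2 k))
  · rintro ⟨k, rfl⟩
    obtain ⟨x, hx⟩ := ZMod.intCast_surjective ((g : ZMod p) ^ k)
    exact ⟨x, by rw [hx, ← pow_mul, mul_two]⟩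

theorem isQNRNP_iff {p : ℕ} [Fact p.Prime] (hp2 : p ≠ 2) {g : (ZMod p)ˣ}
    (hg : ∀ x, x ∈ Subgroup.zpowers g) {m : ℤ} {i : ℕ} (hm : (m : ZMod p) = (g ^ i : (ZMod p)ˣ)) :
    IsQNRNP p m ↔ Odd i ∧ 1 < i.gcd (p - 1) := by
  have hpp : p.Prime := Fact.out
  have : 0 < i.gcd (p - 1) := Nat.gcd_pos_of_pos_right _ (by have := hpp.two_le; lia)
  rw [IsQNRNP, exists_sq_modEq_iff_even hp2 hg hm, isPrimitiveRootModP_iff_coprime hg hm,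
    Nat.not_even_iff_odd]
  exact and_congr_right fun _ ↦ by lia

open Classical in
/-- The indicator of the nonzero residues that are quadratic non-residues and not primitive
roots. -/
noncomputable def qnrnpIndicator (p : ℕ) (x : ZMod p) : ℂ :=
  if x ≠ 0 ∧ IsQNRNP p (x.cast : ℤ) then 1 else 0

theorem qnrnpIndicator_eq_sub {p : ℕ} [Fact p.Prime] (hp2 : p ≠ 2) {g : (ZMod p)ˣ}
    (hg : ∀ x, x ∈ Subgroup.zpowers g) {χ : ℕ → MulChar (ZMod p) ℂ}
    (hχ : ∀ r ∈ (p - 1).primeFactors, orderOf (χ r) = r) :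
    qnrnpIndicator p = sieveIndicator χ {2} - sieveIndicator χ (p - 1).primeFactors := by
  have hpp : p.Prime := Fact.out
  have hp1 : p - 1 ≠ 0 := by have := hpp.two_le; lia
  have h2 : 2 ∈ (p - 1).primeFactors :=
    Nat.mem_primeFactors.mpr ⟨Nat.prime_two, (hpp.even_sub_one hp2).two_dvd, hp1⟩
  ext x
  by_cases hx : x = 0
  · simp [qnrnpIndicator, sieveIndicator, hx]
  obtain ⟨i, hi⟩ := (mem_powers_iff_mem_zpowers.mpr (hg (Units.mk0 x hx)))
  have hi' : x = ((g ^ i : (ZMod p)ˣ) : ZMod p) := (congrArg Units.val hi).symm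
  have hiff := isQNRNP_iff hp2 hg (m := x.cast) (i := i) (by rw [ZMod.intCast_zmod_cast, ← hi'])
  have hcop : (∀ r ∈ (p - 1).primeFactors, χ r x ≠ 1) ↔ i.gcd (p - 1) = 1 := by
    rw [hi']
    constructor
    · intro h
      by_contra hne
      obtain ⟨r, hr, hrd⟩ := Nat.exists_prime_and_dvd hne
      have hmem := Nat.mem_primeFactors.mpr ⟨hr, hrd.trans (Nat.gcd_dvd_right _ _), hp1⟩
      refine h r hmem ?_
      rw [mulChar_pow_generator_eq_one_iff hg, hχ r hmem]
      exact hrd.trans (Nat.gcd_dvd_left _ _)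
    · intro h r hr hr1
      rw [mulChar_pow_generator_eq_one_iff hg, hχ r hr] at hr1
      have := Nat.dvd_gcd hr1 (Nat.dvd_of_mem_primeFactors hr)
      rw [h] at this
      exact (Nat.prime_of_mem_primeFactors hr).not_dvd_one this
  have hsing : (∀ r ∈ ({2} : Finset ℕ), χ r x ≠ 1) ↔ χ 2 x ≠ 1 := by simp
  have hodd : (∀ r ∈ ({2} : Finset ℕ), χ r x ≠ 1) ↔ Odd i := by
    rw [hsing, hi', ne_eq, mulChar_pow_generator_eq_one_iff hg, hχ 2 h2,
      ← even_iff_two_dvd, Nat.not_even_iff_odd]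
  have hpos : 0 < i.gcd (p - 1) := Nat.gcd_pos_of_pos_right _ (by lia)
  have himp : i.gcd (p - 1) = 1 → Odd i := by
    rw [← hcop, ← hodd, hsing]
    exact fun h ↦ h 2 h2
  rw [Pi.sub_apply, qnrnpIndicator, sieveIndicator, sieveIndicator, hiff]
  simp only [hcop, hodd]
  simp only [hx, ne_eq, not_false_eq_true, true_and]
  by_cases h1 : i.gcd (p - 1) = 1
  · simp [h1, himp h1]
  · simp [h1, show 1 < i.gcd (p - 1) by lia]

theorem isCharBounded_qnrnpIndicator_sub {p : ℕ} [Fact p.Prime] (hp2 : p ≠ 2) {θ : ℝ}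
    (hθ : θ = ∏ r ∈ (p - 1).primeFactors, (1 - (r : ℝ)⁻¹)) :
    IsCharBounded (qnrnpIndicator p -
        ((1 / 2 - θ : ℝ) : ℂ) • ((1 : MulChar (ZMod p) ℂ) : ZMod p → ℂ))
      (1 / 2 - θ + θ * (2 ^ #(p - 1).primeFactors - 2)) := by
  have hpp : p.Prime := Fact.out
  have hp1 : p - 1 ≠ 0 := by have := hpp.two_le; lia
  have h2 : 2 ∈ (p - 1).primeFactors :=
    Nat.mem_primeFactors.mpr ⟨Nat.prime_two, (hpp.even_sub_one hp2).two_dvd, hp1⟩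
  obtain ⟨g, hg⟩ := IsCyclic.exists_generator (α := (ZMod p)ˣ)
  have hex (r : ℕ) : ∃ χ : MulChar (ZMod p) ℂ, r ∈ (p - 1).primeFactors → orderOf χ = r := by
    by_cases hr : r ∈ (p - 1).primeFactors
    · obtain ⟨χ, hχ⟩ := MulChar.exists_mulChar_orderOf (ZMod p) (n := r)
        (by rw [ZMod.card]; exact Nat.dvd_of_mem_primeFactors hr)
        (Complex.isPrimitiveRoot_exp r (Nat.prime_of_mem_primeFactors hr).ne_zero)
      exact ⟨χ, fun _ ↦ hχ⟩
    · exact ⟨1, fun h ↦ absurd h hr⟩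
  choose χ hχ using hex
  have hpow (r : ℕ) (hr : r ∈ (p - 1).primeFactors) : 2 ≤ r ∧ χ r ^ r = 1 :=
    ⟨(Nat.prime_of_mem_primeFactors hr).two_le,
      orderOf_dvd_iff_pow_eq_one.mp (hχ r hr).dvd⟩
  set s := (p - 1).primeFactors.erase 2 with hs
  have hins : insert 2 s = (p - 1).primeFactors := insert_erase h2
  have h2s : 2 ∉ s := notMem_erase _ _
  have hcard : #(p - 1).primeFactors = #s + 1 := by rw [← hins, card_insert_of_notMem h2s]
  set κ := ∏ r ∈ s, (1 - (r : ℝ)⁻¹) with hκ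
  have hθκ : θ = κ / 2 := by
    rw [hθ, ← hins, prod_insert h2s]; push_cast; ring
  have hκ0 : 0 ≤ κ := prod_nonneg fun r hr ↦ by
    have : (1 : ℝ) ≤ r := by exact_mod_cast (hpow r (mem_of_mem_erase hr)).1.trans' one_le_two
    rw [sub_nonneg]; exact inv_le_one_of_one_le₀ this
  have hκ1 : κ ≤ 1 := prod_le_one (fun r hr ↦ by
    have : (1 : ℝ) ≤ r := by exact_mod_cast (hpow r (mem_of_mem_erase hr)).1.trans' one_le_two
    rw [sub_nonneg]; exact inv_le_one_of_one_le₀ this) (fun r hr ↦ by simp)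
  have hD := isCharBounded_sieveIndicator_sub (s := s) fun r hr ↦ hpow r (mem_of_mem_erase hr)
  rw [← hκ] at hD
  have e1 := sieveIndicator_insert (s := ∅) (hpow 2 h2).1 (hpow 2 h2).2
  have e2 := sieveIndicator_insert (s := s) (hpow 2 h2).1 (hpow 2 h2).2
  rw [hins] at e2
  rw [insert_empty_eq, sieveIndicator_empty] at e1
  rw [qnrnpIndicator_eq_sub hp2 hg hχ, e1, e2, hcard]
  convert (((IsCharBounded.mulChar (χ 2)).smul (-(1 / 2 - θ : ℝ))).add
    (hD.smul (-(1 / 2 : ℝ)))).add ((hD.mulChar_mul (χ 2)).smul (1 / 2 : ℝ)) using 1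
  · ext x
    have hone : χ 2 x * (1 : MulChar (ZMod p) ℂ) x = χ 2 x := by rw [← MulChar.mul_apply, mul_one]
    simp only [Nat.Ico_succ_singleton, sum_singleton, pow_one, Pi.sub_apply, Pi.add_apply,
      Pi.smul_apply, Pi.mul_apply, smul_eq_mul, mul_sub, hone, mul_left_comm _ (κ : ℂ), hθκ]
    push_cast
    ring
  · rw [← Complex.ofReal_neg, ← Complex.ofReal_neg, Complex.norm_real, Complex.norm_real,
      Complex.norm_real, norm_neg, norm_neg, Real.norm_of_nonneg (by linarith),
      Real.norm_of_nonneg (by norm_num), hθκ]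
    ring

theorem isQNRNP_congr {p : ℕ} {a b : ℤ} (h : (a : ZMod p) = b) : IsQNRNP p a ↔ IsQNRNP p b := by
  simp_rw [IsQNRNP, IsPrimitiveRootModP, ← ZMod.intCast_eq_intCast_iff, h]

theorem sum_qnrnpIndicator_natCast {p : ℕ} (s : Finset ℕ) (hs : ∀ m ∈ s, 1 ≤ m ∧ m < p) :
    ∑ m ∈ s, qnrnpIndicator p m = Set.ncard {m : ℕ | m ∈ s ∧ IsQNRNP p (m : ℤ)} := by
  classical
  have hset : {m : ℕ | m ∈ s ∧ IsQNRNP p (m : ℤ)} =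
      (({m ∈ s | IsQNRNP p (m : ℤ)} : Finset ℕ) : Set ℕ) := by
    simp
  rw [hset, Set.ncard_coe_finset, ← sum_boole]
  refine sum_congr rfl fun m hm ↦ ?_
  obtain ⟨h1, h2⟩ := hs m hm
  have hm0 : (m : ZMod p) ≠ 0 := by
    rw [ne_eq, ZMod.natCast_eq_zero_iff]
    exact Nat.not_dvd_of_pos_of_lt h1 h2
  have hiff : IsQNRNP p ((m : ZMod p).cast : ℤ) ↔ IsQNRNP p (m : ℤ) :=
    isQNRNP_congr (by rw [ZMod.intCast_zmod_cast, Int.cast_natCast])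
  simp [qnrnpIndicator, hm0, hiff]

theorem sum_qnrnpIndicator {p : ℕ} [Fact p.Prime] (hp2 : p ≠ 2) :
    ∑ x, qnrnpIndicator p x =
      Set.ncard {i : ℕ | 1 ≤ i ∧ i ≤ p - 1 ∧ Odd i ∧ 1 < Nat.gcd i (p - 1)} := by
  classical
  have hpp : p.Prime := Fact.out
  have hp1 : 0 < p - 1 := by have := hpp.two_le; lia
  obtain ⟨g, hg⟩ := IsCyclic.exists_generator (α := (ZMod p)ˣ)
  have hord : orderOf g = p - 1 := by
    rw [orderOf_eq_card_of_forall_mem_zpowers hg, Nat.card_eq_fintype_card, ZMod.card_units]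
  have hset : {i : ℕ | 1 ≤ i ∧ i ≤ p - 1 ∧ Odd i ∧ 1 < Nat.gcd i (p - 1)} =
      ↑({i ∈ Icc 1 (p - 1) | Odd i ∧ 1 < Nat.gcd i (p - 1)}) := by
    ext i
    simp [and_assoc]
  rw [hset, Set.ncard_coe_finset, ← sum_boole]
  have hsupp : ∑ x with x ≠ 0, qnrnpIndicator p x = ∑ x, qnrnpIndicator p x :=
    sum_filter_of_ne fun x _ hx h0 ↦ hx (by simp [qnrnpIndicator, h0])
  rw [← hsupp]
  symm
  refine sum_bij (fun i _ ↦ ((g ^ i : (ZMod p)ˣ) : ZMod p)) (fun i _ ↦ by simp)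
    (fun i hi j hj hij ↦ ?_) (fun x hx ↦ ?_) (fun i _ ↦ ?_)
  · rw [Units.val_inj, pow_eq_pow_iff_modEq, hord] at hij
    rw [mem_Icc] at hi hj
    refine hij.eq_of_abs_lt ?_
    rw [abs_lt]
    lia
  · rw [mem_filter] at hx
    obtain ⟨k, hk⟩ := mem_powers_iff_mem_zpowers.mpr (hg (Units.mk0 x hx.2))
    refine ⟨(k + (p - 2)) % (p - 1) + 1, ?_, ?_⟩
    · rw [mem_Icc]
      have := Nat.mod_lt (k + (p - 2)) hp1
      lia
    · have hmod : g ^ ((k + (p - 2)) % (p - 1) + 1) = g ^ k := by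
        rw [pow_eq_pow_iff_modEq, hord]
        refine ((Nat.mod_modEq _ _).add_right 1).trans ?_
        rw [show k + (p - 2) + 1 = k + (p - 1) by lia]
        exact Nat.add_modEq_right
      rw [hmod]
      exact congrArg Units.val hk
  · have hiff := isQNRNP_iff hp2 hg (m := ((g ^ i : (ZMod p)ˣ) : ZMod p).cast) (i := i)
      (ZMod.intCast_zmod_cast _)
    simp only [qnrnpIndicator, hiff, Units.ne_zero, ne_eq, not_false_eq_true, true_and]

theorem norm_sum_coprime_sub_le {p : ℕ} [Fact p.Prime] {f : ZMod p → ℂ} {a : ℂ} {C P : ℝ}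
    (hf : IsCharBounded (f - a • ((1 : MulChar (ZMod p) ℂ) : ZMod p → ℂ)) C) (hP0 : 0 ≤ P)
    (hP : ∀ χ : MulChar (ZMod p) ℂ, χ ≠ 1 → ∀ N : ℕ, ‖∑ n ∈ Ico 1 (N + 1), χ (n : ZMod p)‖ ≤ P)
    {q M : ℕ} (hqM : q * M = p - 1) :
    ‖∑ m ∈ Ico 1 (q * M + 1) with Nat.gcd m M = 1, f m -
        (q * M.totient / (p - 1) : ℂ) * ∑ x, f x‖ ≤ C * (2 ^ #M.primeFactors * P) := by
  have hpp : p.Prime := Fact.out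
  have hM : M ≠ 0 := by
    rintro rfl
    have := hpp.two_le
    lia
  let T : (ZMod p → ℂ) →ₗ[ℂ] ℂ :=
    ∑ m ∈ Ico 1 (q * M + 1) with Nat.gcd m M = 1, LinearMap.proj (m : ZMod p) -
      (q * M.totient / (p - 1) : ℂ) • ∑ x, LinearMap.proj x
  have hT (h : ZMod p → ℂ) : T h = ∑ m ∈ Ico 1 (q * M + 1) with Nat.gcd m M = 1, h m -
      (q * M.totient / (p - 1) : ℂ) * ∑ x, h x := by
    simp [T, LinearMap.sum_apply]
  have hT1 : T (1 : MulChar (ZMod p) ℂ) = 0 := by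
    have hp1 : (p : ℂ) - 1 ≠ 0 := sub_ne_zero.mpr (by exact_mod_cast hpp.one_lt.ne')
    have hone : ∀ m ∈ ({m ∈ Ico 1 (q * M + 1) | Nat.gcd m M = 1} : Finset ℕ),
        (1 : MulChar (ZMod p) ℂ) (m : ZMod p) = 1 := fun m hm ↦ by
      rw [mem_filter, mem_Ico] at hm
      refine MulChar.one_apply (Ne.isUnit ?_)
      rw [ne_eq, ZMod.natCast_eq_zero_iff]
      exact Nat.not_dvd_of_pos_of_lt hm.1.1 (by lia)
    rw [hT, sum_congr rfl hone, MulChar.sum_one_eq_card_units, ZMod.card_units,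
      Nat.cast_sub hpp.one_le, sum_const, card_filter_coprime_Ico_mul]
    push_cast
    field_simp
    simp
  have key : ∀ χ : MulChar (ZMod p) ℂ, ‖T χ‖ ≤ 2 ^ #M.primeFactors * P := by
    intro χ
    by_cases hχ : χ = 1
    · rw [hχ, hT1, norm_zero]
      positivity
    · rw [hT, MulChar.sum_eq_zero_of_ne_one hχ, mul_zero, sub_zero]
      exact norm_sum_mulChar_coprime_le χ (hP χ hχ) hM _
  have := hf T _ key
  rwa [map_sub, map_smul, hT1, smul_zero, sub_zero, hT] at this

theorem card_primeFactors_ge_six {n : ℕ} (hn : n ≠ 0)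
    (h : (n.totient : ℝ) / n < 1 / 6) : 6 ≤ #n.primeFactors := by
  have h1 := one_div_card_add_one_le_prod n.primeFactors
    fun r hr ↦ (Nat.prime_of_mem_primeFactors hr).two_le
  rw [← totient_div_eq_prod hn] at h1
  have h2 := h1.trans_lt h
  rw [div_lt_div_iff₀ (by positivity) (by norm_num)] at h2
  have h3 : (5 : ℝ) < #n.primeFactors := by linarith
  exact_mod_cast h3

theorem two_pow_card_primeFactors_le {n : ℕ} (hn : n ≠ 0) : 2 ^ #n.primeFactors ≤ n := by
  rw [← prod_const]
  exact (prod_le_prod' fun r hr ↦ (Nat.prime_of_mem_primeFactors hr).two_le).trans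
    (Nat.le_of_dvd (Nat.pos_of_ne_zero hn) (Nat.prod_primeFactors_dvd n))

theorem nine_mul_add_one_le_two_mul_two_pow {k : ℕ} (hk : 6 ≤ k) : 9 * (k + 1) ≤ 2 * 2 ^ k := by
  induction k, hk using Nat.le_induction with
  | base => norm_num
  | succ k hk ih => rw [pow_succ]; lia

theorem exists_sum_one_div_sin_le {p : ℕ} (hp : p.Prime) (hp2 : p ≠ 2) {θ : ℝ}
    (hθ : θ = ((p - 1).totient : ℝ) / (p - 1 : ℕ)) :
    ∃ B : ℝ, 0 ≤ B ∧ ∑ v ∈ Ico 1 ((p - 1) / 2 + 1), 1 / Real.sin (Real.pi * v / p) ≤ p / 2 * B ∧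
      (1 / 2 - θ + θ * (2 ^ #(p - 1).primeFactors - 2)) * B ≤
        2 ^ #(p - 1).primeFactors * θ * Real.log p := by
  have hp1 : p - 1 ≠ 0 := by have := hp.two_le; lia
  have hlog : 0 ≤ Real.log p := Real.log_natCast_nonneg p
  obtain ⟨K, rfl⟩ := hp.odd_of_ne_two hp2
  have hK : (2 * K + 1 - 1) / 2 = K := by lia
  rw [hK]
  rcases le_or_gt (1 / 6) θ with h | h
  · refine ⟨Real.log (2 * K + 1 : ℕ), hlog, ?_, ?_⟩
    · exact_mod_cast sum_one_div_sin_le K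
    · exact mul_le_mul_of_nonneg_right (by linarith) hlog
  · have hω := card_primeFactors_ge_six hp1 (hθ ▸ h)
    have hθ1 := one_div_card_add_one_le_prod (2 * K + 1 - 1).primeFactors
      fun r hr ↦ (Nat.prime_of_mem_primeFactors hr).two_le
    rw [← totient_div_eq_prod hp1, ← hθ] at hθ1
    have hlarge : 2 ^ 6 ≤ 2 * K + 1 - 1 :=
      (Nat.pow_le_pow_right two_pos hω).trans (two_pow_card_primeFactors_le hp1)
    have hpow : (9 * (#(2 * K + 1 - 1).primeFactors + 1) : ℝ) ≤
        2 * 2 ^ #(2 * K + 1 - 1).primeFactors := by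
      exact_mod_cast nine_mul_add_one_le_two_mul_two_pow hω
    refine ⟨9 / 10 * Real.log (2 * K + 1 : ℕ), by positivity, ?_, ?_⟩
    · exact_mod_cast sum_one_div_sin_le_of_large K (by lia)
    · rw [div_le_iff₀ (by positivity)] at hθ1
      have hθ0 : 0 ≤ θ := by rw [hθ]; positivity
      rw [← mul_assoc]
      refine mul_le_mul_of_nonneg_right ?_ hlog
      nlinarith

end

theorem stmt10 (p q : ℕ) (hp : p.Prime) (hp2 : p ≠ 2) (hq : 0 < q) (hdvd : q ∣ p - 1)
    (Np : ℕ)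
    (hNp : Np = Set.ncard {m : ℕ | 1 ≤ m ∧ m ≤ p - 1 ∧ Nat.gcd m ((p - 1) / q) = 1 ∧
      IsQNRNP p (m : ℤ)})
    (β₀ : ℕ)
    (hβ₀ : β₀ = Set.ncard {i : ℕ | 1 ≤ i ∧ i ≤ p - 1 ∧ Odd i ∧ 1 < Nat.gcd i (p - 1)}) :
    |(Np : ℝ) - (q * (((p - 1) / q).totient : ℝ) * β₀) / ((p : ℝ) - 1)|
      ≤ 2 ^ (((p - 1) / q).primeFactors.card + (p - 1).primeFactors.card) *
          (((p - 1).totient : ℝ) / ((p : ℝ) - 1)) * Real.sqrt p * Real.log p := by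
  have : Fact p.Prime := ⟨hp⟩
  have hp1 : p - 1 ≠ 0 := by have := hp.two_le; lia
  have hcast : ((p - 1 : ℕ) : ℝ) = p - 1 := by rw [Nat.cast_sub hp.one_le, Nat.cast_one]
  obtain ⟨M, hM⟩ := hdvd
  have hMq : (p - 1) / q = M := by rw [hM, Nat.mul_div_cancel_left _ hq]
  rw [hMq] at hNp ⊢
  obtain ⟨B, hB0, hB, hBle⟩ := exists_sum_one_div_sin_le hp hp2 rfl
  have hbound := norm_sum_coprime_sub_le (P := Real.sqrt p * B)
    (isCharBounded_qnrnpIndicator_sub hp2 (totient_div_eq_prod hp1)) (by positivity)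
    (fun χ hχ N ↦ norm_sum_mulChar_le hp2 hχ N hB) hM.symm
  have hN : {m : ℕ | 1 ≤ m ∧ m ≤ p - 1 ∧ Nat.gcd m M = 1 ∧ IsQNRNP p (m : ℤ)} =
      {m : ℕ | m ∈ {m ∈ Finset.Ico 1 (q * M + 1) | Nat.gcd m M = 1} ∧ IsQNRNP p (m : ℤ)} := by
    ext m
    simp only [Set.mem_ofPred_eq, Finset.mem_filter, Finset.mem_Ico, Nat.lt_succ_iff, hM, and_assoc]
  rw [sum_qnrnpIndicator_natCast _ fun m hm ↦ by
      rw [Finset.mem_filter, Finset.mem_Ico] at hm; lia,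
    ← hN, ← hNp, sum_qnrnpIndicator hp2, ← hβ₀] at hbound
  have hreal : (Np - q * M.totient / (p - 1) * β₀ : ℂ) =
      ((Np - q * M.totient * β₀ / (p - 1) : ℝ) : ℂ) := by
    push_cast
    ring
  rw [hreal, Complex.norm_real, Real.norm_eq_abs] at hbound
  refine hbound.trans ?_
  rw [← hcast]
  calc _ = 2 ^ M.primeFactors.card * Real.sqrt p * (_ * B) := by ring
    _ ≤ 2 ^ M.primeFactors.card * Real.sqrt p * _ :=
      mul_le_mul_of_nonneg_left hBle (by positivity)
    _ = _ := by rw [pow_add]; ring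
end

section
/- Let p be an odd prime, let q be a positive divisor of p−1, and let N_p denote the number of integers m with 1 ≤ m ≤ p−1, gcd(m, (p−1)/q) = 1, and m a QNRNP modulo p. Let β_0(p−1) denote the number of odd integers i with 1 ≤ i ≤ p−1 and gcd(i, p−1) > 1. Then N_p ≥ (φ((p−1)/q)/((p−1)/q)) · β_0(p−1) − 2^{ω((p−1)/q) + ω(p−1)} · (φ(p−1)/(p−1)) · √p · log p. -/
open Real in
/-- A telescoping bound for the cosecant. -/
lemma inv_sin_two_mul_le {u h : ℝ} (hh : 0 < h) (hu : h < u) (hu' : u + h < π / 2) :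
    2 * sin (2 * h) * (sin (2 * u))⁻¹ ≤ log (tan (u + h)) - log (tan (u - h)) := by
  have s1 : 0 < sin (u + h) := sin_pos_of_pos_of_lt_pi (by linarith) (by linarith [pi_pos])
  have s2 : 0 < sin (u - h) := sin_pos_of_pos_of_lt_pi (by linarith) (by linarith [pi_pos])
  have c1 : 0 < cos (u + h) := cos_pos_of_mem_Ioo ⟨by linarith, by linarith⟩
  have c2 : 0 < cos (u - h) := cos_pos_of_mem_Ioo ⟨by linarith, by linarith⟩
  have s3 : 0 < sin (2 * h) := sin_pos_of_pos_of_lt_pi (by linarith) (by linarith [pi_pos])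
  set A := sin (u + h) * cos (u - h) with hA
  set B := sin (u - h) * cos (u + h) with hB
  have hB0 : 0 < B := mul_pos s2 c1
  have hAB : sin (2 * h) = A - B := by
    rw [show 2 * h = (u + h) - (u - h) by ring, sin_sub]; ring
  have hAB' : sin (2 * u) = A + B := by
    rw [show 2 * u = (u + h) + (u - h) by ring, sin_add]; ring
  have key := le_log_one_add_of_nonneg (x := (A - B) / B) (by rw [← hAB]; positivity)
  have hA0 : 0 < A := mul_pos s1 c2
  have e : 1 + (A - B) / B = tan (u + h) / tan (u - h) := by
    rw [tan_eq_sin_div_cos, tan_eq_sin_div_cos, hA, hB]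
    field_simp
    ring
  rw [e, log_div (by rw [tan_eq_sin_div_cos]; positivity)
    (by rw [tan_eq_sin_div_cos]; positivity)] at key
  refine le_trans (le_of_eq ?_) key
  rw [hAB, hAB']
  have : (A - B) / B + 2 = (A + B) / B := by field_simp; ring
  rw [this]
  field_simp

open Real in
lemma three_div_le_sin {p : ℝ} (hp : 3 ≤ p) : 3 / (2 * p) ≤ sin (π / (2 * p)) := by
  have h6 : π / 6 ∈ Set.Icc 0 π := ⟨by positivity, by linarith [pi_pos]⟩
  have h0 : (0 : ℝ) ∈ Set.Icc 0 π := ⟨le_rfl, pi_pos.le⟩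
  have ha : 0 ≤ 3 / p := by positivity
  have hb : 0 ≤ 1 - 3 / p := by rw [sub_nonneg, div_le_one (by linarith)]; exact hp
  have h := strictConcaveOn_sin_Icc.concaveOn.2 h6 h0 ha hb (by ring)
  simp only [smul_eq_mul, sin_pi_div_six, sin_zero, mul_zero, add_zero] at h
  rwa [show 3 / p * (1 / 2) = 3 / (2 * p) by ring,
    show 3 / p * (π / 6) = π / (2 * p) by ring] at h

open Real in
lemma sum_inv_sin_le {p : ℕ} (hp : 3 ≤ p) :
    ∑ a ∈ Finset.Ico 1 p, (sin (π * a / p))⁻¹ ≤ 9 / 10 * (p * log p) := by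
  have hp3 : (3 : ℝ) ≤ p := by exact_mod_cast hp
  have hp0 : (0 : ℝ) < p := by linarith
  set S := ∑ a ∈ Finset.Ico 1 p, (sin (π * a / p))⁻¹
  set h := π / (4 * p) with hh
  have hh0 : 0 < h := by positivity
  have hph : h * (4 * p) = π := by rw [hh]; field_simp
  have h2 : 2 * h = π / (2 * p) := by rw [hh]; field_simp; norm_num
  have tele : 2 * sin (2 * h) * S ≤ log (tan ((2 * p - 1) * h)) - log (tan h) := by
    have := Finset.sum_Ico_sub (fun a : ℕ => log (tan ((2 * (a : ℝ) - 1) * h)))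
      (show 1 ≤ p by omega)
    rw [show (2 * ((1 : ℕ) : ℝ) - 1) * h = h by push_cast; ring] at this
    rw [← this, Finset.mul_sum]
    refine Finset.sum_le_sum fun a ha => ?_
    rw [Finset.mem_Ico] at ha
    have ha1 : (1 : ℝ) ≤ a := by exact_mod_cast ha.1
    have ha2 : (a : ℝ) + 1 ≤ p := by exact_mod_cast ha.2
    have := inv_sin_two_mul_le (u := 2 * a * h) (h := h) hh0 (by nlinarith) (by nlinarith)
    rw [show 2 * a * h + h = (2 * ((a + 1 : ℕ) : ℝ) - 1) * h by push_cast; ring,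
      show 2 * a * h - h = (2 * (a : ℝ) - 1) * h by ring,
      show 2 * (2 * a * h) = π * a / p by rw [hh]; field_simp; norm_num] at this
    exact this
  have e1 : (2 * p - 1) * h = π / 2 - h := by linarith
  have hlt : h < π / 2 := by nlinarith [pi_pos]
  have htan : h < tan h := lt_tan hh0 hlt
  have hinv : log (tan h) ≥ - log (4 / 3 * p) := by
    rw [← log_inv]
    refine log_le_log (by positivity) (le_trans ?_ htan.le)
    rw [hh, inv_le_comm₀ (by positivity) (by positivity), inv_div]
    rw [div_le_iff₀ pi_pos]
    nlinarith [pi_gt_three]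
  rw [e1, tan_pi_div_two_sub, log_inv, h2] at tele
  rw [log_mul (by norm_num) hp0.ne'] at hinv
  have hlog : log (4 / 3) ≤ log p / 3 := by
    have : (3 : ℕ) * log (4 / 3) ≤ log p := by
      rw [← log_pow]
      exact log_le_log (by norm_num) (by norm_num; linarith)
    push_cast at this
    linarith
  have hS0 : 0 ≤ S := Finset.sum_nonneg fun a ha => by
    rw [Finset.mem_Ico] at ha
    have ha2 : (a : ℝ) ≤ p := by exact_mod_cast ha.2.le
    refine inv_nonneg.2 (sin_nonneg_of_nonneg_of_le_pi (by positivity) ?_)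
    rw [div_le_iff₀ hp0]
    exact mul_le_mul_of_nonneg_left ha2 pi_pos.le
  have := mul_le_mul_of_nonneg_right (three_div_le_sin hp3) hS0
  have hl : 0 ≤ log p := log_nonneg (by linarith)
  have h3 : 3 / (2 * p) * S ≤ 4 / 3 * log p := by linarith
  rw [div_mul_eq_mul_div, div_le_iff₀ (by positivity)] at h3
  nlinarith

open Real in
lemma norm_stdAddChar_sub_one {p : ℕ} [NeZero p] {a : ℕ} (ha : a ≤ p) :
    ‖ZMod.stdAddChar (a : ZMod p) - 1‖ = 2 * sin (π * a / p) := by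
  have hp0 : (0 : ℝ) < p := by exact_mod_cast Nat.pos_of_ne_zero (NeZero.ne p)
  have ha2 : (a : ℝ) ≤ p := by exact_mod_cast ha
  have := ZMod.stdAddChar_coe (N := p) a
  rw [Int.cast_natCast] at this
  rw [this, show (2 * π * Complex.I * ((a : ℤ) : ℂ) / p : ℂ) =
    Complex.I * ((2 * π * a / p : ℝ) : ℂ) by push_cast; ring,
    Complex.norm_exp_I_mul_ofReal_sub_one, show 2 * π * a / p / 2 = π * a / p by ring,
    norm_of_nonneg]
  refine mul_nonneg (by norm_num) (sin_nonneg_of_nonneg_of_le_pi (by positivity) ?_)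
  rw [div_le_iff₀ hp0]
  exact mul_le_mul_of_nonneg_left ha2 pi_pos.le

lemma norm_geom_sum_stdAddChar_le {p : ℕ} [NeZero p] {a : ℕ} (ha0 : 0 < a) (ha : a < p) (M : ℕ) :
    ‖∑ m ∈ Finset.range M, ZMod.stdAddChar (a : ZMod p) ^ m‖ ≤
      (Real.sin (Real.pi * a / p))⁻¹ := by
  have hp0 : (0 : ℝ) < p := by exact_mod_cast ha0.trans ha
  have ha2 : (a : ℝ) < p := by exact_mod_cast ha
  have ha3 : (0 : ℝ) < a := by exact_mod_cast ha0
  have hs : 0 < Real.sin (Real.pi * a / p) := by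
    refine Real.sin_pos_of_pos_of_lt_pi (by positivity) ?_
    rw [div_lt_iff₀ hp0]
    exact mul_lt_mul_of_pos_left ha2 Real.pi_pos
  have hn := norm_stdAddChar_sub_one (p := p) ha.le
  have hne : ZMod.stdAddChar (a : ZMod p) ≠ 1 := by
    intro h
    rw [h] at hn
    simp at hn
    linarith
  rw [geom_sum_eq hne, norm_div, hn, div_le_iff₀ (by positivity)]
  refine (norm_sub_le _ _).trans ?_
  rw [norm_pow, AddChar.norm_apply]
  field_simp
  norm_num

/-- Pólya–Vinogradov for a prime modulus, with explicit constant. -/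
lemma norm_sum_mulChar_le_s11 {p : ℕ} [Fact p.Prime] (hp : 3 ≤ p) {χ : MulChar (ZMod p) ℂ}
    (hχ : χ ≠ 1) (M : ℕ) :
    ‖∑ m ∈ Finset.range M, χ (m : ZMod p)‖ ≤ 9 / 10 * (√p * Real.log p) := by
  have hp0 : (0 : ℝ) < p := by positivity
  set ψ : AddChar (ZMod p) ℂ := ZMod.stdAddChar
  have hprim : ψ.IsPrimitive := ZMod.isPrimitive_stdAddChar p
  have hχ' : χ⁻¹ ≠ 1 := inv_ne_one.2 hχ
  set G := gaussSum χ⁻¹ ψ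
  have hG : ‖G‖ = √p := by
    have h := gaussSum_mul_gaussSum_eq_card hχ' hprim
    rw [← star_gaussSum_eq, ZMod.card] at h
    have h' := congrArg norm h
    rw [norm_mul, norm_star, Complex.norm_natCast] at h'
    rw [← h', Real.sqrt_mul_self (norm_nonneg _)]
  have hsum : ∀ m : ZMod p, χ m * G = ∑ a, χ⁻¹ a * ψ (m * a) := by
    intro m
    rcases eq_or_ne m 0 with rfl | hm
    · simp [MulChar.sum_eq_zero_of_ne_one hχ', MulChar.map_zero]
    · have := gaussSum_mulShift_eq χ⁻¹ ψ (Units.mk0 m hm)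
      rw [inv_inv] at this
      exact this.symm
  have hkey : (∑ m ∈ Finset.range M, χ (m : ZMod p)) * G =
      ∑ a, χ⁻¹ a * ∑ m ∈ Finset.range M, ψ a ^ m := by
    rw [Finset.sum_mul]
    simp_rw [hsum, Finset.mul_sum]
    rw [Finset.sum_comm]
    refine Finset.sum_congr rfl fun a _ => Finset.sum_congr rfl fun m _ => ?_
    rw [← AddChar.map_nsmul_eq_pow, nsmul_eq_mul]
  have hbound : ‖(∑ m ∈ Finset.range M, χ (m : ZMod p)) * G‖ ≤ 9 / 10 * (p * Real.log p) := by
    refine le_trans ?_ (sum_inv_sin_le hp)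
    rw [hkey]
    have hre : ∑ a : ZMod p, χ⁻¹ a * ∑ m ∈ Finset.range M, ψ a ^ m =
        ∑ a ∈ Finset.Ico 1 p, χ⁻¹ (a : ZMod p) * ∑ m ∈ Finset.range M, ψ (a : ZMod p) ^ m := by
      have h0 : ∑ a ∈ Finset.range p, χ⁻¹ (a : ZMod p) *
          ∑ m ∈ Finset.range M, ψ (a : ZMod p) ^ m =
          ∑ a : ZMod p, χ⁻¹ a * ∑ m ∈ Finset.range M, ψ a ^ m := by
        refine Finset.sum_bij (fun a _ => (a : ZMod p)) (by simp) ?_ ?_ (by simp)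
        · intro a ha b hb hab
          rw [Finset.mem_range] at ha hb
          rw [ZMod.natCast_eq_natCast_iff'] at hab
          rwa [Nat.mod_eq_of_lt ha, Nat.mod_eq_of_lt hb] at hab
        · intro b _
          exact ⟨b.val, Finset.mem_range.2 (ZMod.val_lt b), ZMod.natCast_zmod_val b⟩
      rw [← h0, Finset.range_eq_Ico, Finset.sum_eq_sum_Ico_succ_bot (by omega)]
      simp [MulChar.map_zero]
    rw [hre]
    refine (norm_sum_le _ _).trans (Finset.sum_le_sum fun a ha => ?_)
    rw [Finset.mem_Ico] at ha
    rw [norm_mul]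
    have h1 : ‖χ⁻¹ (a : ZMod p)‖ ≤ 1 := DirichletCharacter.norm_le_one χ⁻¹ _
    exact (mul_le_of_le_one_left (norm_nonneg _) h1).trans
      (norm_geom_sum_stdAddChar_le (by omega) ha.2 M)
  rw [norm_mul, hG] at hbound
  have hs : (0 : ℝ) < √p := Real.sqrt_pos.2 hp0
  have : (p : ℝ) = √p * √p := (Real.mul_self_sqrt hp0.le).symm
  rw [show 9 / 10 * ((p : ℝ) * Real.log p) = 9 / 10 * (√p * Real.log p) * √p by
    nth_rewrite 1 [this]; ring] at hbound
  exact le_of_mul_le_mul_right hbound hs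

lemma norm_sum_sifted_le {p : ℕ} {χ : MulChar (ZMod p) ℂ} {B : ℝ}
    (hB : ∀ M, ‖∑ m ∈ Finset.range M, χ (m : ZMod p)‖ ≤ B)
    (S : Finset ℕ) (hS : ∀ r ∈ S, r.Prime) (M : ℕ) :
    ‖∑ m ∈ Finset.range M with ∀ r ∈ S, ¬ r ∣ m, χ (m : ZMod p)‖ ≤ 2 ^ S.card * B := by
  classical
  induction S using Finset.induction_on generalizing M with
  | empty => simpa using hB M
  | insert r S hr ih =>
    have hS' : ∀ s ∈ S, s.Prime := fun s hs => hS s (Finset.mem_insert_of_mem hs)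
    have hrp : r.Prime := hS r (Finset.mem_insert_self r S)
    have hsplit : ∑ m ∈ Finset.range M with ∀ s ∈ insert r S, ¬ s ∣ m, χ (m : ZMod p) =
        ∑ m ∈ Finset.range M with ∀ s ∈ S, ¬ s ∣ m, χ (m : ZMod p) -
        χ (r : ZMod p) *
          ∑ m ∈ Finset.range ((M + r - 1) / r) with ∀ s ∈ S, ¬ s ∣ m, χ (m : ZMod p) := by
      rw [eq_sub_iff_add_eq, ← Finset.sum_filter_not_add_sum_filter
        ((Finset.range M).filter fun m => ∀ s ∈ S, ¬ s ∣ m) (fun m => r ∣ m)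
        (fun m => χ (m : ZMod p)), Finset.filter_filter, Finset.filter_filter]
      congr 1
      · refine Finset.sum_congr (Finset.filter_congr fun m _ => ?_) fun _ _ => rfl
        simp only [Finset.forall_mem_insert]
        tauto
      · rw [Finset.mul_sum]
        refine Finset.sum_bij (fun m _ => r * m) ?_ ?_ ?_ ?_
        · intro m hm
          simp only [Finset.mem_filter, Finset.mem_range] at hm ⊢
          refine ⟨?_, fun s hs hd => ?_, dvd_mul_right r m⟩
          · have h1 := hm.1
            have : (m + 1) * r ≤ M + r - 1 := (Nat.le_div_iff_mul_le hrp.pos).1 h1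
            have := hrp.pos
            rw [mul_comm r m]
            rw [add_mul] at *
            omega
          · rcases (hS' s hs).dvd_mul.1 hd with h | h
            · exact hr ((Nat.prime_dvd_prime_iff_eq (hS' s hs) hrp).1 h ▸ hs)
            · exact hm.2 s hs h
        · intro a _ b _ h
          exact Nat.eq_of_mul_eq_mul_left hrp.pos h
        · intro b hb
          simp only [Finset.mem_filter, Finset.mem_range] at hb
          obtain ⟨hbM, hbS, k, rfl⟩ := hb
          refine ⟨k, ?_, rfl⟩
          simp only [Finset.mem_filter, Finset.mem_range]
          refine ⟨?_, fun s hs hd => hbS s hs (hd.mul_left r)⟩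
          refine (Nat.le_div_iff_mul_le hrp.pos).2 ?_
          rw [Nat.succ_mul, mul_comm k r]
          omega
        · intro a _
          push_cast
          rw [map_mul]
    rw [hsplit, Finset.card_insert_of_notMem hr, pow_succ]
    have h1 := ih hS' M
    have h2 := ih hS' ((M + r - 1) / r)
    have h3 : ‖χ (r : ZMod p)‖ ≤ 1 := DirichletCharacter.norm_le_one χ _
    refine (norm_sub_le _ _).trans ?_
    rw [norm_mul]
    have := mul_le_of_le_one_left (norm_nonneg
      (∑ m ∈ Finset.range ((M + r - 1) / r) with ∀ s ∈ S, ¬ s ∣ m, χ (m : ZMod p))) h3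
    linarith

lemma exists_mulChar_apply_pow_eq_one_iff {p : ℕ} [Fact p.Prime] {g : (ZMod p)ˣ}
    (hg : ∀ x, x ∈ Subgroup.zpowers g) {r : ℕ} (hr : r.Prime) (hd : r ∣ p - 1) :
    ∃ χ : MulChar (ZMod p) ℂ, orderOf χ = r ∧
      ∀ k : ℕ, χ ((g ^ k : (ZMod p)ˣ) : ZMod p) = 1 ↔ r ∣ k := by
  have : NeZero r := ⟨hr.ne_zero⟩
  obtain ⟨χ, hχ⟩ := MulChar.exists_mulChar_orderOf (ZMod p) (n := r) (R := ℂ)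
    (by rwa [ZMod.card]) (Complex.isPrimitiveRoot_exp r hr.ne_zero)
  refine ⟨χ, hχ, fun k => ?_⟩
  have : Fact r.Prime := ⟨hr⟩
  have h1 : χ g ^ r = 1 := by
    rw [← MulChar.pow_apply_coe, ← hχ, pow_orderOf_eq_one, MulChar.one_apply_coe]
  have h2 : χ g ≠ 1 := by
    intro h
    have : χ = 1 := (MulChar.eq_iff hg χ 1).2 (by rw [h, MulChar.one_apply_coe])
    rw [this, orderOf_one] at hχ
    exact hr.one_lt.ne hχ
  rw [Units.val_pow_eq_pow_val, map_pow, ← orderOf_dvd_iff_pow_eq_one, orderOf_eq_prime h1 h2]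

/-- Fourier expansion, with control of the `ℓ¹` norm, of the indicator function of the common
non-kernel of characters of distinct prime orders. -/
lemma exists_mulChar_expansion {p : ℕ} [Fact p.Prime] [Fintype (MulChar (ZMod p) ℂ)]
    (η : ℕ → MulChar (ZMod p) ℂ) (S : Finset ℕ) (hS : ∀ r ∈ S, r.Prime)
    (hη : ∀ r ∈ S, orderOf (η r) = r) :
    ∃ c : MulChar (ZMod p) ℂ → ℂ,
      (∀ x : (ZMod p)ˣ, (if ∀ r ∈ S, η r x ≠ 1 then 1 else 0) = ∑ χ, c χ * χ x) ∧
      c 1 = ∏ r ∈ S, (1 - 1 / (r : ℂ)) ∧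
      ∑ χ, ‖c χ‖ ≤ ∏ r ∈ S, (2 * (1 - 1 / (r : ℝ))) ∧
      ∀ χ, c χ ≠ 0 → χ ^ (∏ r ∈ S, r) = 1 := by
  classical
  induction S using Finset.induction_on with
  | empty =>
    refine ⟨Pi.single 1 1, ?_, by simp, ?_, ?_⟩
    · intro x
      simp [Pi.single_apply]
    · simp [Pi.single_apply, apply_ite norm]
    · intro χ h
      simpa [Pi.single_apply] using h
  | insert r S hr ih =>
    obtain ⟨c, hc, hc1, hcn, hcs⟩ := ih (fun s hs => hS s (Finset.mem_insert_of_mem hs))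
      (fun s hs => hη s (Finset.mem_insert_of_mem hs))
    have hrp : r.Prime := hS r (Finset.mem_insert_self r S)
    have hηr : orderOf (η r) = r := hη r (Finset.mem_insert_self r S)
    have hr0 : (r : ℂ) ≠ 0 := by exact_mod_cast hrp.ne_zero
    have hr0' : (0 : ℝ) < r := by exact_mod_cast hrp.pos
    have hcop : Nat.Coprime r (∏ s ∈ S, s) := by
      refine Nat.Coprime.prod_right fun s hs => ?_
      exact (Nat.coprime_primes hrp (hS s (Finset.mem_insert_of_mem hs))).2
        (fun h => hr (h ▸ hs))
    refine ⟨fun χ => (1 - 1 / (r : ℂ)) * c χ -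
      1 / (r : ℂ) * ∑ i ∈ Finset.Ico 1 r, c (χ * η r ^ i), ?_, ?_, ?_, ?_⟩
    · intro x
      set z := (η r)⁻¹ x with hz
      have hz1 : z = 1 ↔ η r x = 1 := by
        rw [hz, MulChar.inv_apply_eq_inv', inv_eq_one]
      have hzr : z ^ r = 1 := by
        have : η r ^ r = 1 := by
          nth_rewrite 2 [← hηr]
          exact pow_orderOf_eq_one _
        rw [hz, ← MulChar.pow_apply_coe, inv_pow, this, inv_one, MulChar.one_apply_coe]
      have hshift : ∀ i : ℕ, ∑ χ, c (χ * η r ^ i) * χ x = z ^ i * ∑ χ, c χ * χ x := by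
        intro i
        rw [Finset.mul_sum]
        refine Fintype.sum_equiv (Equiv.mulRight (η r ^ i)) _ _ fun χ => ?_
        simp only [Equiv.coe_mulRight]
        have : z ^ i * (χ * η r ^ i) x = χ x := by
          rw [hz, ← MulChar.pow_apply_coe, ← MulChar.mul_apply, inv_pow, mul_comm χ,
            inv_mul_cancel_left]
        rw [mul_left_comm, this]
      have hL : ∑ χ, ((1 - 1 / (r : ℂ)) * c χ -
          1 / (r : ℂ) * ∑ i ∈ Finset.Ico 1 r, c (χ * η r ^ i)) * χ x =
          (1 - 1 / (r : ℂ) * ∑ i ∈ Finset.range r, z ^ i) * ∑ χ, c χ * χ x := by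
        simp_rw [sub_mul, Finset.sum_sub_distrib, mul_assoc, ← Finset.mul_sum, Finset.sum_mul]
        rw [Finset.sum_comm]
        simp_rw [hshift, ← Finset.sum_mul]
        rw [Finset.range_eq_Ico, Finset.sum_eq_sum_Ico_succ_bot hrp.pos]
        ring
      rw [hL, ← hc]
      simp only [Finset.forall_mem_insert]
      by_cases h : z = 1
      · have h' := hz1.1 h
        simp [h, h', hr0]
      · have h' : η r x ≠ 1 := fun h' => h (hz1.2 h')
        rw [geom_sum_eq h, hzr]
        simp [h']
    · rw [Finset.prod_insert hr, ← hc1]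
      have : ∑ i ∈ Finset.Ico 1 r, c (1 * η r ^ i) = 0 := by
        refine Finset.sum_eq_zero fun i hi => ?_
        by_contra hne
        have := hcs _ hne
        rw [one_mul, ← pow_mul, ← orderOf_dvd_iff_pow_eq_one, hηr] at this
        rw [Finset.mem_Ico] at hi
        exact Nat.not_dvd_of_pos_of_lt (by omega) hi.2 (hcop.dvd_of_dvd_mul_right this)
      simp only [this, mul_zero, sub_zero]
    · rw [Finset.prod_insert hr]
      have h1r : 0 ≤ 1 - 1 / (r : ℝ) := by
        rw [sub_nonneg, div_le_one hr0']
        exact_mod_cast hrp.one_lt.le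
      have hle : ∀ χ, ‖(1 - 1 / (r : ℂ)) * c χ -
          1 / (r : ℂ) * ∑ i ∈ Finset.Ico 1 r, c (χ * η r ^ i)‖ ≤
          (1 - 1 / (r : ℝ)) * ‖c χ‖ + 1 / (r : ℝ) * ∑ i ∈ Finset.Ico 1 r, ‖c (χ * η r ^ i)‖ := by
        intro χ
        refine (norm_sub_le _ _).trans ?_
        rw [norm_mul, norm_mul]
        have e1 : ‖1 - 1 / (r : ℂ)‖ = 1 - 1 / (r : ℝ) := by
          rw [show 1 - 1 / (r : ℂ) = ((1 - 1 / (r : ℝ) : ℝ) : ℂ) by push_cast; rfl,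
            Complex.norm_real, Real.norm_of_nonneg h1r]
        have e2 : ‖1 / (r : ℂ)‖ = 1 / (r : ℝ) := by simp
        rw [e1, e2]
        gcongr
        exact norm_sum_le _ _
      refine (Finset.sum_le_sum fun χ _ => hle χ).trans ?_
      rw [Finset.sum_add_distrib, ← Finset.mul_sum, ← Finset.mul_sum, Finset.sum_comm]
      have hsh : ∀ i : ℕ, ∑ χ, ‖c (χ * η r ^ i)‖ = ∑ χ, ‖c χ‖ := fun i =>
        Fintype.sum_equiv (Equiv.mulRight (η r ^ i)) _ _ fun χ => rfl
      simp_rw [hsh]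
      rw [Finset.sum_const, Nat.card_Ico, nsmul_eq_mul, Nat.cast_sub hrp.one_lt.le]
      have : (1 - 1 / (r : ℝ)) * ∑ χ, ‖c χ‖ + 1 / r * ((r - (1 : ℕ)) * ∑ χ, ‖c χ‖) =
          2 * (1 - 1 / (r : ℝ)) * ∑ χ, ‖c χ‖ := by
        field_simp
        push_cast
        ring
      rw [this]
      gcongr
    · intro χ hχ
      obtain ⟨i, hi⟩ : ∃ i : ℕ, c (χ * η r ^ i) ≠ 0 := by
        by_contra! h
        refine hχ ?_
        have h0 := h 0
        rw [pow_zero, mul_one] at h0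
        simp [h, h0]
      have := hcs _ hi
      rw [Finset.prod_insert hr, mul_comm, pow_mul]
      rw [mul_pow, mul_eq_one_iff_eq_inv] at this
      have h1 : η r ^ r = 1 := by
        nth_rewrite 2 [← hηr]
        exact pow_orderOf_eq_one _
      rw [this, inv_pow, ← pow_mul, ← pow_mul, show i * ((∏ s ∈ S, s) * r) = r * (i * ∏ s ∈ S, s) by
        ring, pow_mul, h1, one_pow, inv_one]

lemma norm_charsum_sub_main_le {p : ℕ} [Fact p.Prime] [Fintype (MulChar (ZMod p) ℂ)]
    (c : MulChar (ZMod p) ℂ → ℂ) (η : MulChar (ZMod p) ℂ) {n : ℕ} (hη : orderOf η = 2)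
    (hn : Odd n) (hc : ∀ χ, c χ ≠ 0 → χ ^ n = 1) {P C D : ℝ} (hc1 : c 1 = P) (hP0 : 0 ≤ P)
    (hP1 : P ≤ 1) (hcC : ∑ χ, ‖c χ‖ ≤ C) (A : Finset ℕ)
    (hD : ∀ χ : MulChar (ZMod p) ℂ, χ ≠ 1 → ‖∑ m ∈ A, χ (m : ZMod p)‖ ≤ D) :
    ‖∑ m ∈ A, 1 / 2 * (1 - η m) * ((1 : MulChar (ZMod p) ℂ) m - ∑ χ, c χ * χ m) -
      1 / 2 * (1 - P) * ∑ m ∈ A, (1 : MulChar (ZMod p) ℂ) m‖ ≤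
      (1 / 2 * (1 - P) + (C - P)) * D := by
  classical
  set T : MulChar (ZMod p) ℂ → ℂ := fun χ => ∑ m ∈ A, χ (m : ZMod p) with hT
  have hη1 : η ≠ 1 := by
    rintro rfl
    simp at hη
  have hD0 : 0 ≤ D := (norm_nonneg _).trans (hD η hη1)
  have hexp : ∑ m ∈ A, 1 / 2 * (1 - η m) * ((1 : MulChar (ZMod p) ℂ) m - ∑ χ, c χ * χ m) =
      1 / 2 * (T 1 - T η) - 1 / 2 * ∑ χ, c χ * (T χ - T (η * χ)) := by
    have h1 : ∀ χ, T χ - T (η * χ) = ∑ m ∈ A, (1 - η m) * χ m := by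
      intro χ
      simp only [hT, MulChar.mul_apply, ← Finset.sum_sub_distrib]
      exact Finset.sum_congr rfl fun m _ => by ring
    have h2 : T 1 - T η = ∑ m ∈ A, (1 - η m) * (1 : MulChar (ZMod p) ℂ) m := by
      rw [← h1 1, mul_one]
    rw [h2]
    simp_rw [h1, Finset.mul_sum]
    rw [Finset.sum_comm (s := Finset.univ), ← Finset.sum_sub_distrib]
    refine Finset.sum_congr rfl fun m _ => ?_
    rw [mul_sub, Finset.mul_sum]
    congr 1
    · ring
    · exact Finset.sum_congr rfl fun χ _ => by ring
  rw [hexp, Fintype.sum_eq_add_sum_compl 1, hc1, mul_one]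
  have hre : 1 / 2 * (T 1 - T η) - 1 / 2 * (P * (T 1 - T η) +
      ∑ χ ∈ {1}ᶜ, c χ * (T χ - T (η * χ))) - 1 / 2 * (1 - P) * T 1 =
      -(1 / 2 * (1 - P) * T η) - 1 / 2 * ∑ χ ∈ {1}ᶜ, c χ * (T χ - T (η * χ)) := by ring
  change ‖_ - 1 / 2 * (1 - P) * T 1‖ ≤ _
  rw [hre]
  refine (norm_sub_le _ _).trans ?_
  rw [norm_neg, norm_mul, norm_mul (1 / 2 : ℂ) (∑ χ ∈ {1}ᶜ, c χ * (T χ - T (η * χ)))]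
  have e1 : ‖(1 / 2 * (1 - P) : ℂ)‖ = 1 / 2 * (1 - P) := by
    rw [show (1 / 2 * (1 - P) : ℂ) = ((1 / 2 * (1 - P) : ℝ) : ℂ) by push_cast; ring,
      Complex.norm_real, Real.norm_of_nonneg (by linarith)]
  have e2 : ‖(1 / 2 : ℂ)‖ = 1 / 2 := by norm_num
  rw [e1, e2]
  have hsum : ‖∑ χ ∈ {1}ᶜ, c χ * (T χ - T (η * χ))‖ ≤ (∑ χ ∈ {1}ᶜ, ‖c χ‖) * (2 * D) := by
    rw [Finset.sum_mul]
    refine (norm_sum_le _ _).trans (Finset.sum_le_sum fun χ hχ => ?_)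
    rw [norm_mul]
    by_cases h0 : c χ = 0
    · simp [h0]
    refine mul_le_mul_of_nonneg_left ?_ (norm_nonneg _)
    have hχ1 : χ ≠ 1 := by simpa using hχ
    have hχη : η * χ ≠ 1 := by
      intro h
      have h2 : η ^ n = 1 := by
        rw [mul_eq_one_iff_eq_inv.1 h, inv_pow, hc χ h0, inv_one]
      rw [← orderOf_dvd_iff_pow_eq_one, hη] at h2
      exact (Nat.not_even_iff_odd.2 hn) (even_iff_two_dvd.2 h2)
    exact (norm_sub_le _ _).trans (by linarith [hD χ hχ1, hD _ hχη])
  have hC' : ∑ χ ∈ {1}ᶜ, ‖c χ‖ ≤ C - P := by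
    rw [Fintype.sum_eq_add_sum_compl 1, hc1, Complex.norm_real, Real.norm_of_nonneg hP0] at hcC
    linarith
  have h3 : 1 / 2 * (1 - P) * ‖T η‖ ≤ 1 / 2 * (1 - P) * D :=
    mul_le_mul_of_nonneg_left (hD η hη1) (by linarith)
  have h4 := mul_le_mul_of_nonneg_right hC' (show 0 ≤ 2 * D by linarith)
  linarith

lemma card_coprime_Ico_mul (q N : ℕ) :
    ((Finset.Ico 1 (1 + q * N)).filter fun m => N.Coprime m).card = q * N.totient := by
  induction q with
  | zero => simp
  | succ q ih =>
    rw [← Finset.Ico_union_Ico_eq_Ico (b := 1 + q * N) (by omega)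
      (by rw [Nat.succ_mul]; omega), Finset.filter_union, Finset.card_union_of_disjoint, ih,
      Nat.succ_mul q N, ← add_assoc, Nat.filter_coprime_Ico_eq_totient, Nat.succ_mul]
    exact Finset.disjoint_filter_filter (Finset.Ico_disjoint_Ico_consecutive _ _ _)

lemma exists_int_sq_modEq_iff {p : ℕ} [Fact p.Prime] {g : (ZMod p)ˣ}
    {η : MulChar (ZMod p) ℂ} (h2 : orderOf η = 2)
    (hη : ∀ k : ℕ, η ((g ^ k : (ZMod p)ˣ) : ZMod p) = 1 ↔ 2 ∣ k) {k : ℕ} {m : ℤ}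
    (hm : (m : ZMod p) = (g ^ k : (ZMod p)ˣ)) :
    (∃ x : ℤ, x ^ 2 ≡ m [ZMOD p]) ↔ η (m : ZMod p) = 1 := by
  constructor
  · rintro ⟨x, hx⟩
    rw [← ZMod.intCast_eq_intCast_iff] at hx
    push_cast at hx
    have hx0 : IsUnit (x : ZMod p) := by
      have : IsUnit ((x : ZMod p) ^ 2) := by rw [hx, hm]; exact Units.isUnit _
      exact (isUnit_pow_iff (by norm_num)).1 this
    rw [← hx, map_pow, ← MulChar.pow_apply' _ (by norm_num), ← h2, pow_orderOf_eq_one,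
      MulChar.one_apply hx0]
  · rw [hm, hη]
    rintro ⟨j, rfl⟩
    obtain ⟨x, hx⟩ := ZMod.intCast_surjective ((g ^ j : (ZMod p)ˣ) : ZMod p)
    refine ⟨x, ?_⟩
    rw [← ZMod.intCast_eq_intCast_iff, hm]
    push_cast
    rw [hx]
    push_cast
    ring

lemma isPrimitiveRootModP_iff {p : ℕ} [Fact p.Prime] {g : (ZMod p)ˣ}
    (hg : ∀ x, x ∈ Subgroup.zpowers g) {η : ℕ → MulChar (ZMod p) ℂ}
    (hη : ∀ r ∈ (p - 1).primeFactors, ∀ k : ℕ, η r ((g ^ k : (ZMod p)ˣ) : ZMod p) = 1 ↔ r ∣ k)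
    {k : ℕ} {m : ℤ} (hm : (m : ZMod p) = (g ^ k : (ZMod p)ˣ)) :
    IsPrimitiveRootModP p m ↔ ∀ r ∈ (p - 1).primeFactors, η r (m : ZMod p) ≠ 1 := by
  constructor
  · intro h r hr h1
    obtain ⟨j, hj⟩ := h g (Units.ne_zero g)
    have : η r ((g ^ 1 : (ZMod p)ˣ) : ZMod p) = 1 := by
      rw [pow_one, ← hj, map_pow, h1, one_pow]
    rw [hη r hr] at this
    exact (Nat.prime_of_mem_primeFactors hr).one_lt.ne' (Nat.dvd_one.1 this)
  · intro h a ha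
    have hord : orderOf g = p - 1 := by
      rw [orderOf_eq_card_of_forall_mem_zpowers hg, Nat.card_eq_fintype_card, ZMod.card_units]
    have hp1 : p - 1 ≠ 0 := by have := (Fact.out : p.Prime).one_lt; omega
    have hcop : k.Coprime (orderOf g) := by
      rw [hord]
      refine Nat.Coprime.symm (Nat.coprime_of_dvd fun r hr hd hk => ?_)
      have hmem : r ∈ (p - 1).primeFactors := Nat.mem_primeFactors.2 ⟨hr, hd, hp1⟩
      refine h r hmem ?_
      rw [hm, hη r hmem]
      exact hk
    obtain ⟨j, hj⟩ := exists_pow_eq_self_of_coprime hcop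
    obtain ⟨i, hi⟩ := (mem_powers_iff_mem_zpowers (x := g)).2 (hg (Units.mk0 a ha))
    refine ⟨j * i, ?_⟩
    rw [hm, pow_mul, ← Units.val_pow_eq_pow_val, hj, ← Units.val_pow_eq_pow_val]
    simp only at hi
    rw [hi, Units.val_mk0]

open Classical in
lemma ite_isQNRNP_eq {p : ℕ} [Fact p.Prime] (hp : 2 ∣ p - 1) {g : (ZMod p)ˣ}
    (hg : ∀ x, x ∈ Subgroup.zpowers g) {η : ℕ → MulChar (ZMod p) ℂ}
    (hη : ∀ r ∈ (p - 1).primeFactors, ∀ k : ℕ, η r ((g ^ k : (ZMod p)ˣ) : ZMod p) = 1 ↔ r ∣ k)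
    (hη2 : orderOf (η 2) = 2) (m : ℤ) (hm : (m : ZMod p) ≠ 0) :
    (if IsQNRNP p m then 1 else 0 : ℂ) = 1 / 2 * (1 - η 2 (m : ZMod p)) *
      (1 - if ∀ r ∈ (p - 1).primeFactors.erase 2, η r (m : ZMod p) ≠ 1 then 1 else 0) := by
  have hp1 : p - 1 ≠ 0 := by have := (Fact.out : p.Prime).one_lt; omega
  have h2 : 2 ∈ (p - 1).primeFactors := Nat.mem_primeFactors.2 ⟨Nat.prime_two, hp, hp1⟩
  obtain ⟨k, hk⟩ := (mem_powers_iff_mem_zpowers (x := g)).2 (hg (Units.mk0 _ hm))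
  have hmk : (m : ZMod p) = (g ^ k : (ZMod p)ˣ) := by
    simp only at hk
    rw [hk, Units.val_mk0]
  have hsq : η 2 (m : ZMod p) ^ 2 = 1 := by
    have : η 2 ^ 2 = 1 := by
      nth_rewrite 2 [← hη2]
      exact pow_orderOf_eq_one _
    rw [hmk, ← MulChar.pow_apply_coe, this, MulChar.one_apply_coe]
  rw [IsQNRNP, exists_int_sq_modEq_iff hη2 (hη 2 h2) hmk, isPrimitiveRootModP_iff hg hη hmk]
  rcases mul_self_eq_one_iff.1 ((sq _).symm.trans hsq) with h | h
  · simp [h]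
  · have hne : η 2 (m : ZMod p) ≠ 1 := by rw [h]; norm_num
    have : (∀ r ∈ (p - 1).primeFactors, η r (m : ZMod p) ≠ 1) ↔
        ∀ r ∈ (p - 1).primeFactors.erase 2, η r (m : ZMod p) ≠ 1 := by
      refine ⟨fun H r hr => H r (Finset.mem_of_mem_erase hr), fun H r hr => ?_⟩
      by_cases hr2 : r = 2
      · rw [hr2]; exact hne
      · exact H r (Finset.mem_erase.2 ⟨hr2, hr⟩)
    rw [this]
    by_cases hF : ∀ r ∈ (p - 1).primeFactors.erase 2, η r (m : ZMod p) ≠ 1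
    · rw [if_pos hF, if_neg fun H => H.2 hF, sub_self, mul_zero]
    · rw [if_neg hF, if_pos ⟨hne, hF⟩, h]
      norm_num

lemma nine_mul_pow_le (k : ℕ) : 9 * (3 / 2 : ℝ) ^ k ≤ 2 * 2 ^ k + 27 := by
  rcases lt_or_ge k 4 with h | h
  · interval_cases k <;> norm_num
  · induction k, h using Nat.le_induction with
    | base => norm_num
    | succ k hk ih =>
      have : (2 : ℝ) ^ 4 ≤ 2 ^ k := pow_le_pow_right₀ (by norm_num) hk
      rw [pow_succ, pow_succ]
      linarith

lemma two_thirds_pow_card_le_prod {S : Finset ℕ} (hS : ∀ r ∈ S, 3 ≤ r) :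
    (2 / 3 : ℝ) ^ S.card ≤ ∏ r ∈ S, (1 - 1 / (r : ℝ)) := by
  rw [← Finset.prod_const]
  refine Finset.prod_le_prod (fun _ _ => by norm_num) fun r hr => ?_
  have : (3 : ℝ) ≤ r := by exact_mod_cast hS r hr
  have : 1 / (r : ℝ) ≤ 1 / 3 := one_div_le_one_div_of_le (by norm_num) this
  linarith

lemma const_mul_le_two_pow_mul {S : Finset ℕ} (hS : ∀ r ∈ S, 3 ≤ r) :
    9 / 10 * (1 / 2 * (1 - ∏ r ∈ S, (1 - 1 / (r : ℝ))) +
      (2 ^ S.card * ∏ r ∈ S, (1 - 1 / (r : ℝ)) - ∏ r ∈ S, (1 - 1 / (r : ℝ)))) ≤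
      2 ^ S.card * ∏ r ∈ S, (1 - 1 / (r : ℝ)) := by
  set P := ∏ r ∈ S, (1 - 1 / (r : ℝ))
  have h1 := mul_le_mul_of_nonneg_right (two_thirds_pow_card_le_prod hS)
    (show (0 : ℝ) ≤ 2 * 2 ^ S.card + 27 by positivity)
  have h2 := mul_le_mul_of_nonneg_left (nine_mul_pow_le S.card)
    (show (0 : ℝ) ≤ (2 / 3) ^ S.card by positivity)
  have h3 : (2 / 3 : ℝ) ^ S.card * (9 * (3 / 2) ^ S.card) = 9 := by
    rw [mul_left_comm, ← mul_pow]
    norm_num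
  rw [h3] at h2
  linarith

lemma card_odd_not_coprime {n : ℕ} (hn : 2 ∣ n) (hn0 : n ≠ 0) :
    2 * (((Finset.Ico 1 (1 + n)).filter fun i => Odd i ∧ 1 < Nat.gcd i n).card +
      n.totient) = n := by
  obtain ⟨h, rfl⟩ := hn
  have h1 := card_coprime_Ico_mul h 2
  have h2 := Nat.filter_coprime_Ico_eq_totient (2 * h) 1
  rw [Nat.totient_two, mul_one, mul_comm h 2] at h1
  suffices ((Finset.Ico 1 (1 + 2 * h)).filter fun i => Odd i ∧ 1 < Nat.gcd i (2 * h)).card +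
      (2 * h).totient = h by rw [this]
  rw [← h2]
  refine Eq.trans ?_ h1
  rw [← Finset.card_union_of_disjoint, ← Finset.filter_or]
  · congr 1
    refine Finset.filter_congr fun i _ => ?_
    have hpos : 0 < Nat.gcd i (2 * h) := Nat.gcd_pos_of_pos_right _ (by omega)
    rw [Nat.coprime_two_left, Nat.coprime_comm, Nat.Coprime]
    constructor
    · rintro (h | h')
      · exact h.1
      · exact Nat.coprime_two_right.1 (Nat.Coprime.coprime_dvd_right (dvd_mul_right 2 h) h')
    · intro hi
      by_cases h1 : Nat.gcd i (2 * h) = 1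
      · exact Or.inr h1
      · exact Or.inl ⟨hi, by omega⟩
  · refine Finset.disjoint_filter.2 fun i _ hi hc => ?_
    rw [Nat.coprime_comm, Nat.Coprime] at hc
    omega

lemma totient_div_eq_half_mul_prod {n : ℕ} (hn : 2 ∣ n) (hn0 : n ≠ 0) :
    (n.totient : ℝ) = n * (1 / 2 * ∏ r ∈ n.primeFactors.erase 2, (1 - 1 / (r : ℝ))) := by
  have h := Nat.totient_eq_mul_prod_factors n
  have h2 : 2 ∈ n.primeFactors := Nat.mem_primeFactors.2 ⟨Nat.prime_two, hn, hn0⟩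
  have h' : (n.totient : ℝ) = n * ∏ r ∈ n.primeFactors, (1 - (r : ℝ)⁻¹) := by
    have := congrArg ((↑) : ℚ → ℝ) h
    push_cast at this
    exact this
  rw [h', ← Finset.mul_prod_erase _ _ h2]
  simp only [one_div]
  norm_num

open Classical in
/-- The count of sifted non-residues that are not primitive roots, up to a character sum error. -/
lemma abs_card_isQNRNP_sub_le {p : ℕ} [Fact p.Prime] (hp : 2 ∣ p - 1) (A : Finset ℕ)
    (hA : ∀ m ∈ A, 1 ≤ m ∧ m < p) {D : ℝ}
    (hD : ∀ χ : MulChar (ZMod p) ℂ, χ ≠ 1 → ‖∑ m ∈ A, χ (m : ZMod p)‖ ≤ D) {P : ℝ}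
    (hP : P = ∏ r ∈ (p - 1).primeFactors.erase 2, (1 - 1 / (r : ℝ))) :
    |((A.filter fun m : ℕ => IsQNRNP p m).card : ℝ) - 1 / 2 * (1 - P) * A.card| ≤
      (1 / 2 * (1 - P) + (2 ^ ((p - 1).primeFactors.erase 2).card * P - P)) * D := by
  obtain ⟨g, hg⟩ := IsCyclic.exists_generator (α := (ZMod p)ˣ)
  have hex : ∀ r ∈ (p - 1).primeFactors, ∃ χ : MulChar (ZMod p) ℂ, orderOf χ = r ∧
      ∀ k : ℕ, χ ((g ^ k : (ZMod p)ˣ) : ZMod p) = 1 ↔ r ∣ k := fun r hr =>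
    exists_mulChar_apply_pow_eq_one_iff hg (Nat.prime_of_mem_primeFactors hr)
      (Nat.dvd_of_mem_primeFactors hr)
  choose! η hη using hex
  have hp1 : p - 1 ≠ 0 := by have := (Fact.out : p.Prime).one_lt; omega
  have h2 : 2 ∈ (p - 1).primeFactors := Nat.mem_primeFactors.2 ⟨Nat.prime_two, hp, hp1⟩
  set S := (p - 1).primeFactors.erase 2
  have hSp : ∀ r ∈ S, r.Prime := fun r hr =>
    Nat.prime_of_mem_primeFactors (Finset.mem_of_mem_erase hr)
  have := Fintype.ofFinite (MulChar (ZMod p) ℂ)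
  obtain ⟨c, hc, hc1, hcn, hcs⟩ := exists_mulChar_expansion η S hSp
    fun r hr => (hη r (Finset.mem_of_mem_erase hr)).1
  have hodd : Odd (∏ r ∈ S, r) := by
    refine Nat.coprime_two_left.1 (Nat.Coprime.prod_right fun r hr => ?_)
    exact (Nat.coprime_primes Nat.prime_two (hSp r hr)).2 (Finset.ne_of_mem_erase hr).symm
  have hfac : ∀ r ∈ S, 0 ≤ 1 - 1 / (r : ℝ) ∧ 1 - 1 / (r : ℝ) ≤ 1 := by
    intro r hr
    have h1 : (1 : ℝ) ≤ r := by exact_mod_cast (hSp r hr).one_lt.le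
    have h0 : 1 / (r : ℝ) ≤ 1 := by rw [div_le_one (by linarith)]; exact h1
    have : 0 ≤ 1 / (r : ℝ) := by positivity
    constructor <;> linarith
  have hP0 : 0 ≤ P := hP ▸ Finset.prod_nonneg fun r hr => (hfac r hr).1
  have hP1 : P ≤ 1 := hP ▸ Finset.prod_le_one (fun r hr => (hfac r hr).1) fun r hr => (hfac r hr).2
  have hc1' : c 1 = P := by
    rw [hc1, hP]
    push_cast
    rfl
  rw [Finset.prod_mul_distrib, Finset.prod_const, ← hP] at hcn
  have key := norm_charsum_sub_main_le c (η 2) (hη 2 h2).1 hodd hcs hc1' hP0 hP1 hcn A hD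
  have hne : ∀ m ∈ A, (m : ZMod p) ≠ 0 := by
    intro m hm h
    rw [ZMod.natCast_eq_zero_iff] at h
    exact Nat.not_dvd_of_pos_of_lt (hA m hm).1 (hA m hm).2 h
  have hone : ∀ m ∈ A, (1 : MulChar (ZMod p) ℂ) (m : ZMod p) = 1 := fun m hm =>
    MulChar.one_apply (isUnit_iff_ne_zero.2 (hne m hm))
  have e1 : ∑ m ∈ A, (1 : MulChar (ZMod p) ℂ) (m : ZMod p) = A.card := by
    rw [Finset.sum_congr rfl hone]
    simp
  have e2 : ∑ m ∈ A, 1 / 2 * (1 - η 2 m) * ((1 : MulChar (ZMod p) ℂ) m - ∑ χ, c χ * χ m) =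
      (A.filter fun m : ℕ => IsQNRNP p m).card := by
    rw [Finset.card_filter]
    push_cast
    refine Finset.sum_congr rfl fun m hm => ?_
    have h := ite_isQNRNP_eq hp hg (fun r hr => (hη r hr).2) (hη 2 h2).1 (m : ℤ)
      (by rw [Int.cast_natCast]; exact hne m hm)
    rw [Int.cast_natCast] at h
    rw [h, hone m hm]
    have h' := hc (Units.mk0 _ (hne m hm))
    rw [Units.val_mk0] at h'
    rw [← h']
    congr!
  rw [e1, e2] at key
  rw [← Real.norm_eq_abs, ← Complex.norm_real]
  push_cast
  exact key

lemma coprime_iff_forall_primeFactors {N m : ℕ} (hN : N ≠ 0) :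
    N.Coprime m ↔ ∀ r ∈ N.primeFactors, ¬ r ∣ m := by
  constructor
  · intro h r hr hd
    have hr' := Nat.mem_primeFactors.1 hr
    exact hr'.1.one_lt.ne' (Nat.dvd_one.1 (h ▸ Nat.dvd_gcd hr'.2.1 hd))
  · intro h
    exact Nat.coprime_of_dvd fun r hr hrN hrm => h r (Nat.mem_primeFactors.2 ⟨hr, hrN, hN⟩) hrm

theorem stmt11 (p q : ℕ) (hp : p.Prime) (hp2 : p ≠ 2) (hq : 0 < q) (hdvd : q ∣ p - 1)
    (Np : ℕ)
    (hNp : Np = Set.ncard {m : ℕ | 1 ≤ m ∧ m ≤ p - 1 ∧ Nat.gcd m ((p - 1) / q) = 1 ∧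
      IsQNRNP p (m : ℤ)})
    (β₀ : ℕ)
    (hβ₀ : β₀ = Set.ncard {i : ℕ | 1 ≤ i ∧ i ≤ p - 1 ∧ Odd i ∧ 1 < Nat.gcd i (p - 1)}) :
    (Np : ℝ) ≥ ((((p - 1) / q).totient : ℝ) / (((p - 1) / q : ℕ) : ℝ)) * β₀ -
        2 ^ (((p - 1) / q).primeFactors.card + (p - 1).primeFactors.card) *
          (((p - 1).totient : ℝ) / ((p : ℝ) - 1)) * Real.sqrt p * Real.log p := by
  classical
  have : Fact p.Prime := ⟨hp⟩
  have hp3 : 3 ≤ p := by have := hp.two_le; omega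
  have hpodd : Odd p := hp.odd_of_ne_two hp2
  have h2n : 2 ∣ p - 1 := by obtain ⟨k, rfl⟩ := hpodd; exact ⟨k, by omega⟩
  have hn0 : p - 1 ≠ 0 := by omega
  obtain ⟨N, hN⟩ := hdvd
  have hNq : (p - 1) / q = N := by rw [hN, Nat.mul_div_cancel_left _ hq]
  rw [hNq] at hNp ⊢
  have hN0 : N ≠ 0 := by rintro rfl; omega
  have hpN : p = 1 + q * N := by omega
  have hcastn : ((p - 1 : ℕ) : ℝ) = p - 1 := by rw [Nat.cast_sub (by omega)]; simp
  have hn0' : ((p - 1 : ℕ) : ℝ) ≠ 0 := by exact_mod_cast hn0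
  set S := (p - 1).primeFactors.erase 2 with hS
  have hS3 : ∀ r ∈ S, 3 ≤ r := by
    intro r hr
    have h1 := (Nat.prime_of_mem_primeFactors (Finset.mem_of_mem_erase hr)).two_le
    have h2 := Finset.ne_of_mem_erase hr
    omega
  have hScard : S.card + 1 = (p - 1).primeFactors.card :=
    Finset.card_erase_add_one (Nat.mem_primeFactors.2 ⟨Nat.prime_two, h2n, hn0⟩)
  have htot := totient_div_eq_half_mul_prod h2n hn0
  have hconst := const_mul_le_two_pow_mul hS3
  set P := ∏ r ∈ S, (1 - 1 / (r : ℝ)) with hP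
  set A := (Finset.Ico 1 p).filter fun m => N.Coprime m with hA
  have hAcard : A.card = q * N.totient := by
    rw [hA, hpN]
    exact card_coprime_Ico_mul q N
  set L := √p * Real.log p with hL
  have hL0 : 0 ≤ L := mul_nonneg (Real.sqrt_nonneg _) (Real.log_natCast_nonneg p)
  have hD : ∀ χ : MulChar (ZMod p) ℂ, χ ≠ 1 → ‖∑ m ∈ A, χ (m : ZMod p)‖ ≤
      2 ^ N.primeFactors.card * (9 / 10 * L) := by
    intro χ hχ
    have h := norm_sum_sifted_le (norm_sum_mulChar_le_s11 hp3 hχ) N.primeFactors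
      (fun r hr => Nat.prime_of_mem_primeFactors hr) p
    convert h using 2
    refine Finset.sum_subset_zero_on_sdiff ?_ ?_ fun _ _ => rfl
    · intro m hm
      rw [hA, Finset.mem_filter, Finset.mem_Ico, coprime_iff_forall_primeFactors hN0] at hm
      exact Finset.mem_filter.2 ⟨Finset.mem_range.2 hm.1.2, hm.2⟩
    · intro m hm
      rw [Finset.mem_sdiff, hA, Finset.mem_filter, Finset.mem_filter, Finset.mem_Ico,
        Finset.mem_range, coprime_iff_forall_primeFactors hN0] at hm
      have : m = 0 := by
        by_contra h0
        exact hm.2 ⟨⟨by omega, hm.1.1⟩, hm.1.2⟩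
      rw [this, Nat.cast_zero, MulChar.map_zero]
  have key := abs_card_isQNRNP_sub_le h2n A
    (fun m hm => Finset.mem_Ico.1 (Finset.mem_filter.1 hm).1) hD hP
  have hNp' : Np = (A.filter fun m : ℕ => IsQNRNP p m).card := by
    rw [hNp, ← Set.ncard_coe_finset]
    congr 1
    ext m
    simp only [Set.mem_ofPred_eq, Finset.coe_filter, hA, Finset.mem_filter, Finset.mem_Ico]
    rw [Nat.coprime_comm, Nat.Coprime]
    constructor
    · rintro ⟨h1, h2, h3, h4⟩
      exact ⟨⟨⟨h1, by omega⟩, h3⟩, h4⟩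
    · rintro ⟨⟨⟨h1, h2⟩, h3⟩, h4⟩
      exact ⟨h1, by omega, h3, h4⟩
  have hβ : 2 * (β₀ + (p - 1).totient) = p - 1 := by
    refine Eq.trans ?_ (card_odd_not_coprime h2n hn0)
    rw [hβ₀, ← Set.ncard_coe_finset]
    congr 3
    ext i
    simp only [Set.mem_ofPred_eq, Finset.coe_filter, Finset.mem_Ico]
    rw [and_assoc]
    refine and_congr_right fun _ => and_congr_left fun _ => ?_
    omega
  have hβ' : (β₀ : ℝ) = 1 / 2 * (1 - P) * (p - 1 : ℕ) := by
    have : (2 * (β₀ + (p - 1).totient) : ℝ) = (p - 1 : ℕ) := by exact_mod_cast hβ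
    rw [htot] at this
    linarith
  have hmain : (N.totient : ℝ) / N * β₀ = 1 / 2 * (1 - P) * A.card := by
    have hN0' : (N : ℝ) ≠ 0 := by exact_mod_cast hN0
    rw [hβ', hAcard, hN]
    push_cast
    field_simp
  have herr : 2 ^ (N.primeFactors.card + (p - 1).primeFactors.card) *
      (((p - 1).totient : ℝ) / ((p : ℝ) - 1)) * √p * Real.log p =
      2 ^ N.primeFactors.card * L * (2 ^ S.card * P) := by
    rw [htot, ← hcastn, mul_div_cancel_left₀ _ hn0', ← hScard, pow_add, pow_succ, hL]
    ring
  rw [hmain, herr, hNp']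
  have h1 := (abs_le.1 key).1
  have h2 := mul_le_mul_of_nonneg_left hconst
    (show 0 ≤ 2 ^ N.primeFactors.card * L by positivity)
  linarith
end

section
/- Let p be an odd prime and let q be a positive divisor of p−1. Let β_0(p−1) denote the number of odd integers i with 1 ≤ i ≤ p−1 and gcd(i, p−1) > 1. If β_0(p−1) > 4^{ω(p−1)} · √p · log p, then there exists an integer m with 1 ≤ m ≤ p−1 and gcd(m, (p−1)/q) = 1 such that m is a QNRNP modulo p. -/
lemma ZMod.sum_eq_sum_range {M : Type*} [AddCommMonoid M] (p : ℕ) [NeZero p] (f : ZMod p → M) :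
    ∑ x, f x = ∑ j ∈ Finset.range p, f j := by
  refine (Finset.sum_nbij' (fun j : ℕ => (j : ZMod p)) ZMod.val ?_ ?_ ?_ ?_ ?_).symm
  · simp
  · intro a _; simpa using ZMod.val_lt a
  · intro a ha; simpa using ZMod.val_cast_of_lt (Finset.mem_range.1 ha)
  · simp
  · simp

lemma sum_inv_succ_le_log (h : ℕ) :
    ∑ j ∈ Finset.range h, 1 / ((j : ℝ) + 1) ≤ Real.log (2 * h + 1) := by
  induction h with
  | zero => simp
  | succ h ih =>
    rw [Finset.sum_range_succ]
    have hx : (0 : ℝ) ≤ 2 / (2 * h + 1) := by positivity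
    have h1 := Real.le_log_one_add_of_nonneg hx
    have h2 : 2 * (2 / (2 * (h : ℝ) + 1)) / (2 / (2 * h + 1) + 2) = 1 / ((h : ℝ) + 1) := by
      field_simp
      ring
    have h3 : (2 * ((h + 1 : ℕ) : ℝ) + 1) = (2 * h + 1) * (1 + 2 / (2 * h + 1)) := by
      push_cast
      field_simp
      ring
    rw [h3, Real.log_mul (by positivity) (by positivity)]
    linarith

lemma norm_gaussSum_stdAddChar {p : ℕ} [Fact p.Prime] {χ : MulChar (ZMod p) ℂ} (hχ : χ ≠ 1) :
    ‖gaussSum χ (ZMod.stdAddChar (N := p))‖ = √p := by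
  have h := gaussSum_mul_gaussSum_eq_card hχ (ZMod.isPrimitive_stdAddChar p)
  rw [← star_gaussSum_eq, ZMod.card, ← starRingEnd_apply, Complex.mul_conj,
    Complex.normSq_eq_norm_sq] at h
  have h' : ‖gaussSum χ (ZMod.stdAddChar (N := p))‖ ^ 2 = p := by exact_mod_cast h
  rw [← h', Real.sqrt_sq (norm_nonneg _)]

lemma MulChar.mul_gaussSum_inv {p : ℕ} [Fact p.Prime] {χ : MulChar (ZMod p) ℂ} (hχ : χ ≠ 1)
    (ψ : AddChar (ZMod p) ℂ) (x : ZMod p) :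
    χ x * gaussSum χ⁻¹ ψ = gaussSum χ⁻¹ (ψ.mulShift x) := by
  by_cases hx : x = 0
  · subst hx
    rw [AddChar.mulShift_zero, gaussSum_one_right (inv_ne_one.2 hχ), MulChar.map_zero, zero_mul]
  · have := gaussSum_mulShift_eq χ⁻¹ ψ (Units.mk0 x hx)
    rw [inv_inv] at this
    exact this.symm

lemma norm_geom_sum_stdAddChar_le_s12 {p : ℕ} [NeZero p] (N : ℕ) {j : ℕ} (hj : 0 < j)
    (hjp : 2 * j ≤ p) :
    ‖∑ k ∈ Finset.range N, (ZMod.stdAddChar (j : ZMod p)) ^ k‖ ≤ p / (2 * j) := by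
  have hp : (0 : ℝ) < p := by exact_mod_cast Nat.pos_of_neZero p
  have hj' : (0 : ℝ) < j := by exact_mod_cast hj
  have hjp' : 2 * (j : ℝ) ≤ p := by exact_mod_cast hjp
  set z : ℂ := ZMod.stdAddChar (j : ZMod p) with hz
  have hlow : 4 * (j : ℝ) / p ≤ ‖z - 1‖ := by
    have hexp : z = Complex.exp (Complex.I * ((2 * Real.pi * j / p : ℝ) : ℂ)) := by
      have := ZMod.stdAddChar_coe (N := p) (j : ℤ)
      rw [Int.cast_natCast] at this
      rw [hz, this]
      congr 1
      push_cast
      ring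
    rw [hexp, Complex.norm_exp_I_mul_ofReal_sub_one]
    have h0 : 2 * Real.pi * j / p / 2 ≤ Real.pi / 2 := by
      rw [div_div, div_le_div_iff₀ (by positivity) (by positivity)]
      nlinarith [Real.pi_pos]
    have h1 := Real.mul_le_sin (x := 2 * Real.pi * j / p / 2) (by positivity) h0
    have h2 : 2 / Real.pi * (2 * Real.pi * j / p / 2) = 2 * j / p := by
      field_simp
    rw [h2] at h1
    calc 4 * (j : ℝ) / p = 2 * (2 * j / p) := by ring
      _ ≤ 2 * Real.sin (2 * Real.pi * j / p / 2) := by linarith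
      _ ≤ _ := Real.le_norm_self _
  have hpos : 0 < ‖z - 1‖ := lt_of_lt_of_le (by positivity) hlow
  have hz1 : z ≠ 1 := fun h => by simp [h] at hpos
  rw [geom_sum_eq hz1, norm_div, div_le_div_iff₀ hpos (by positivity)]
  have hzn : ‖z‖ = 1 := AddChar.norm_apply _ _
  have hnum : ‖z ^ N - 1‖ ≤ 2 := by
    refine (norm_sub_le _ _).trans ?_
    rw [norm_pow, hzn]
    norm_num
  rw [div_le_iff₀ hp] at hlow
  nlinarith

/-- The **Pólya–Vinogradov inequality** for a prime modulus. -/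
theorem norm_sum_mulChar_interval_le {p : ℕ} [Fact p.Prime] (hp2 : p ≠ 2)
    {χ : MulChar (ZMod p) ℂ} (hχ : χ ≠ 1) (a : ZMod p) (N : ℕ) :
    ‖∑ k ∈ Finset.range N, χ (a + k)‖ ≤ √p * Real.log p := by
  have hpp : p.Prime := Fact.out
  set ψ : AddChar (ZMod p) ℂ := ZMod.stdAddChar with hψ
  have hp0 : (0 : ℝ) < p := by exact_mod_cast hpp.pos
  have hs : 0 < √(p : ℝ) := Real.sqrt_pos.2 hp0
  set S : ZMod p → ℝ := fun t => ‖∑ k ∈ Finset.range N, ψ t ^ k‖ with hS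
  have hneg (t : ZMod p) : S (-t) = S t := by
    simp only [hS]
    rw [← RCLike.norm_conj (∑ k ∈ Finset.range N, ψ t ^ k), map_sum]
    simp only [map_pow, AddChar.map_neg_eq_conj]
  have hexpand : (∑ k ∈ Finset.range N, χ (a + k)) * gaussSum χ⁻¹ ψ =
      ∑ t, χ⁻¹ t * (ψ (a * t) * ∑ k ∈ Finset.range N, ψ t ^ k) := by
    simp_rw [Finset.sum_mul, MulChar.mul_gaussSum_inv hχ, gaussSum]
    rw [Finset.sum_comm]
    refine Finset.sum_congr rfl fun t _ => ?_
    rw [Finset.mul_sum, Finset.mul_sum]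
    refine Finset.sum_congr rfl fun k _ => ?_
    rw [AddChar.mulShift_apply, add_mul, AddChar.map_add_eq_mul, ← nsmul_eq_mul,
      AddChar.map_nsmul_eq_pow]
  obtain ⟨h, hh⟩ := hpp.odd_of_ne_two hp2
  have hterm (t : ZMod p) :
      ‖χ⁻¹ t * (ψ (a * t) * ∑ k ∈ Finset.range N, ψ t ^ k)‖ ≤ if t = 0 then 0 else S t := by
    split_ifs with ht
    · rw [ht, MulChar.map_zero, zero_mul, norm_zero]
    · rw [norm_mul, norm_mul, AddChar.norm_apply, one_mul]
      exact mul_le_of_le_one_left (norm_nonneg _) (DirichletCharacter.norm_le_one χ⁻¹ t)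
  have hcast (j : ℕ) (hj : j < 2 * h) : ((j + 1 : ℕ) : ZMod p) ≠ 0 := by
    rw [Ne, ZMod.natCast_eq_zero_iff]
    exact Nat.not_dvd_of_pos_of_lt (by omega) (by omega)
  have hsmall (j : ℕ) (hj : j < h) : S ((j + 1 : ℕ) : ZMod p) ≤ p / 2 * (1 / ((j : ℝ) + 1)) := by
    refine (norm_geom_sum_stdAddChar_le_s12 N (j := j + 1) (by omega) (by omega)).trans_eq ?_
    push_cast
    field_simp
  have hsum : ∑ t : ZMod p, (if t = 0 then 0 else S t) ≤ p * Real.log p := by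
    rw [ZMod.sum_eq_sum_range p, congrArg Finset.range hh, Finset.sum_range_succ', Nat.cast_zero, if_pos rfl, add_zero]
    calc _ = ∑ j ∈ Finset.range (2 * h), S ((j + 1 : ℕ) : ZMod p) :=
          Finset.sum_congr rfl fun j hj => if_neg (hcast j (Finset.mem_range.1 hj))
      _ = ∑ j ∈ Finset.range h, S ((j + 1 : ℕ) : ZMod p) +
          ∑ j ∈ Finset.range h, S ((j + 1 : ℕ) : ZMod p) := by
        rw [two_mul, Finset.sum_range_add]
        congr 1
        rw [← Finset.sum_range_reflect]
        refine Finset.sum_congr rfl fun j hj => ?_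
        have hj := Finset.mem_range.1 hj
        rw [← hneg]
        congr 1
        rw [neg_eq_iff_add_eq_zero, ← Nat.cast_add, ZMod.natCast_eq_zero_iff]
        exact ⟨1, by omega⟩
      _ ≤ 2 * ∑ j ∈ Finset.range h, p / 2 * (1 / ((j : ℝ) + 1)) := by
        rw [← two_mul]
        gcongr with j hj
        exact hsmall j (Finset.mem_range.1 hj)
      _ = p * ∑ j ∈ Finset.range h, 1 / ((j : ℝ) + 1) := by
        rw [← Finset.mul_sum]
        ring
      _ ≤ p * Real.log p := by
        have := sum_inv_succ_le_log h
        have hh' : (p : ℝ) = 2 * h + 1 := by exact_mod_cast hh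
        rw [← hh'] at this
        gcongr
  have hfin : ‖∑ k ∈ Finset.range N, χ (a + k)‖ * √p ≤ p * Real.log p := by
    rw [← norm_gaussSum_stdAddChar (inv_ne_one.2 hχ), ← norm_mul, hexpand]
    exact (norm_sum_le _ _).trans ((Finset.sum_le_sum fun t _ => hterm t).trans hsum)
  rw [← mul_le_mul_iff_left₀ hs]
  calc _ ≤ p * Real.log p := hfin
    _ = √p * Real.log p * √p := by
      rw [mul_right_comm, Real.mul_self_sqrt hp0.le]

lemma norm_sum_mulChar_odd_multiples_le {p : ℕ} [Fact p.Prime] (hp2 : p ≠ 2)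
    {χ : MulChar (ZMod p) ℂ} (hχ : χ ≠ 1) (M : ℕ) {d : ℕ} (hd : Odd d) :
    ‖∑ m ∈ Finset.range M with Odd m ∧ d ∣ m, χ (m : ZMod p)‖ ≤ √p * Real.log p := by
  have hd0 : 0 < d := hd.pos
  have hlt (k : ℕ) : d * (2 * k + 1) < M ↔ k < (M + d - 1) / d / 2 := by
    have h1 : k < (M + d - 1) / d / 2 ↔ 2 * k + 2 ≤ (M + d - 1) / d := by omega
    rw [h1, Nat.le_div_iff_mul_le hd0]
    have h2 : (2 * k + 2) * d = d * (2 * k + 1) + d := by ring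
    rw [h2]
    omega
  have h2 : (2 : ZMod p) ≠ 0 := by
    intro h
    have h' : ((2 : ℕ) : ZMod p) = 0 := by exact_mod_cast h
    rw [ZMod.natCast_eq_zero_iff] at h'
    exact hp2 ((Nat.prime_dvd_prime_iff_eq Fact.out Nat.prime_two).1 h')
  have hsum : ∑ m ∈ Finset.range M with Odd m ∧ d ∣ m, χ (m : ZMod p) =
      χ (d * 2) * ∑ k ∈ Finset.range ((M + d - 1) / d / 2), χ (2⁻¹ + k) := by
    rw [Finset.mul_sum]
    refine (Finset.sum_nbij' (fun k => d * (2 * k + 1)) (fun m => m / d / 2) ?_ ?_ ?_ ?_ ?_).symm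
    · intro k hk
      simp only [Finset.mem_filter, Finset.mem_range]
      exact ⟨(hlt k).2 (Finset.mem_range.1 hk), hd.mul (odd_two_mul_add_one k),
        Nat.dvd_mul_right _ _⟩
    · intro m hm
      simp only [Finset.mem_filter, Finset.mem_range] at hm
      obtain ⟨hmM, hodd, c, rfl⟩ := hm
      obtain ⟨k, rfl⟩ := (Nat.odd_mul.1 hodd).2
      rw [Finset.mem_range, Nat.mul_div_cancel_left _ hd0, ← hlt]
      have : (2 * k + 1) / 2 = k := by omega
      rwa [this]
    · intro k _
      simp only [Nat.mul_div_cancel_left _ hd0]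
      omega
    · intro m hm
      simp only [Finset.mem_filter] at hm
      obtain ⟨_, hodd, c, rfl⟩ := hm
      obtain ⟨k, rfl⟩ := (Nat.odd_mul.1 hodd).2
      have : (2 * k + 1) / 2 = k := by omega
      simp only [Nat.mul_div_cancel_left _ hd0, this]
    · intro k _
      rw [← map_mul]
      congr 1
      push_cast
      field_simp
      ring
  rw [hsum, norm_mul]
  exact (mul_le_of_le_one_left (norm_nonneg _) (DirichletCharacter.norm_le_one χ _)).trans
    (norm_sum_mulChar_interval_le hp2 hχ _ _)

lemma norm_sum_mulChar_odd_sieved_le {p : ℕ} [Fact p.Prime] (hp2 : p ≠ 2)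
    {χ : MulChar (ZMod p) ℂ} (hχ : χ ≠ 1) (M : ℕ) (S : Finset ℕ)
    (hS : ∀ l ∈ S, l.Prime ∧ Odd l) {d : ℕ} (hd : Odd d) (hdS : ∀ l ∈ S, l.Coprime d) :
    ‖∑ m ∈ Finset.range M with (Odd m ∧ d ∣ m) ∧ ∀ l ∈ S, ¬ l ∣ m, χ (m : ZMod p)‖ ≤
      2 ^ S.card * (√p * Real.log p) := by
  induction S using Finset.induction_on generalizing d with
  | empty => simpa using norm_sum_mulChar_odd_multiples_le hp2 hχ M hd
  | insert q S hq ih =>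
    have hS' : ∀ l ∈ S, l.Prime ∧ Odd l := fun l hl => hS l (Finset.mem_insert_of_mem hl)
    have hdS' : ∀ l ∈ S, l.Coprime d := fun l hl => hdS l (Finset.mem_insert_of_mem hl)
    obtain ⟨hqp, hqo⟩ := hS q (Finset.mem_insert_self _ _)
    have hqd := hdS q (Finset.mem_insert_self _ _)
    have h1 := ih hS' hd hdS'
    have h2 := ih hS' (hqo.mul hd) (d := q * d) fun l hl =>
      Nat.Coprime.mul_right ((Nat.coprime_primes (hS' l hl).1 hqp).2
        (by rintro rfl; exact hq hl)) (hdS' l hl)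
    have hsplit := Finset.sum_filter_add_sum_filter_not
      ({m ∈ Finset.range M | (Odd m ∧ d ∣ m) ∧ ∀ l ∈ S, ¬ l ∣ m}) (fun m => q ∣ m)
      (fun m => χ (m : ZMod p))
    rw [Finset.filter_filter, Finset.filter_filter] at hsplit
    have e1 : {m ∈ Finset.range M | ((Odd m ∧ d ∣ m) ∧ ∀ l ∈ S, ¬ l ∣ m) ∧ q ∣ m} =
        {m ∈ Finset.range M | (Odd m ∧ q * d ∣ m) ∧ ∀ l ∈ S, ¬ l ∣ m} := by
      refine Finset.filter_congr fun m _ => ?_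
      have : q * d ∣ m ↔ q ∣ m ∧ d ∣ m :=
        ⟨fun h => ⟨(Nat.dvd_mul_right _ _).trans h, (Nat.dvd_mul_left _ _).trans h⟩,
          fun h => hqd.mul_dvd_of_dvd_of_dvd h.1 h.2⟩
      rw [this]
      tauto
    have e2 : {m ∈ Finset.range M | ((Odd m ∧ d ∣ m) ∧ ∀ l ∈ S, ¬ l ∣ m) ∧ ¬ q ∣ m} =
        {m ∈ Finset.range M | (Odd m ∧ d ∣ m) ∧ ∀ l ∈ insert q S, ¬ l ∣ m} := by
      refine Finset.filter_congr fun m _ => ?_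
      rw [Finset.forall_mem_insert]
      tauto
    rw [e1, e2] at hsplit
    rw [eq_sub_of_add_eq' hsplit, Finset.card_insert_of_notMem hq, pow_succ]
    refine (norm_sub_le _ _).trans ?_
    linarith

lemma norm_sum_mulChar_coprime_le_s12 {p : ℕ} [Fact p.Prime] (hp2 : p ≠ 2)
    {χ : MulChar (ZMod p) ℂ} (hχ : χ ≠ 1) {n : ℕ} (hn : n ≠ 0) (hn2 : 2 ∣ n) :
    ‖∑ m ∈ Finset.Ico 1 (1 + n) with n.Coprime m, χ (m : ZMod p)‖ ≤
      2 ^ (n.primeFactors.card - 1) * (√p * Real.log p) := by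
  have h2 : 2 ∈ n.primeFactors := Nat.mem_primeFactors.2 ⟨Nat.prime_two, hn2, hn⟩
  have key := norm_sum_mulChar_odd_sieved_le hp2 hχ (1 + n) (n.primeFactors.erase 2)
    (fun l hl => by
      have hl' := Finset.mem_erase.1 hl
      have hlp := Nat.prime_of_mem_primeFactors hl'.2
      exact ⟨hlp, hlp.odd_of_ne_two hl'.1⟩) odd_one (fun l _ => Nat.coprime_one_right l)
  rw [Finset.card_erase_of_mem h2] at key
  convert key using 3
  ext m
  simp only [Finset.mem_filter, Finset.mem_Ico, Finset.mem_range, one_dvd, and_true]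
  have hcop : n.Coprime m ↔ Odd m ∧ ∀ l ∈ n.primeFactors.erase 2, ¬ l ∣ m := by
    rw [← Nat.not_even_iff_odd, even_iff_two_dvd,
      ← Finset.forall_mem_insert (p := fun l => ¬ l ∣ m), Finset.insert_erase h2]
    constructor
    · intro h l hl hlm
      exact Nat.not_coprime_of_dvd_of_dvd (Nat.prime_of_mem_primeFactors hl).one_lt
        (Nat.dvd_of_mem_primeFactors hl) hlm h
    · intro h
      exact Nat.coprime_of_dvd fun l hl hln hlm =>
        h l (Nat.mem_primeFactors.2 ⟨hl, hln, hn⟩) hlm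
  rw [hcop]
  constructor
  · exact fun h => ⟨h.1.2, h.2⟩
  · exact fun h => ⟨⟨h.2.1.pos, h.1⟩, h.2⟩

/-- The difference between the sum of `f` over the integers `1 ≤ m ≤ p - 1` coprime to `p - 1`
and its expected value. -/
noncomputable def coprimeDiscrepancy (p : ℕ) [NeZero p] (f : ZMod p → ℂ) : ℂ :=
  ∑ m ∈ Finset.Ico 1 (1 + (p - 1)) with (p - 1).Coprime m, f m -
    ((p - 1).totient : ℂ) / ((p - 1 : ℕ) : ℂ) * ∑ x, f x

lemma coprimeDiscrepancy_sub (p : ℕ) [NeZero p] (f g : ZMod p → ℂ) :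
    coprimeDiscrepancy p (fun x => f x - g x) =
      coprimeDiscrepancy p f - coprimeDiscrepancy p g := by
  simp only [coprimeDiscrepancy, Finset.sum_sub_distrib]
  ring

lemma coprimeDiscrepancy_const_mul (p : ℕ) [NeZero p] (c : ℂ) (f : ZMod p → ℂ) :
    coprimeDiscrepancy p (fun x => c * f x) = c * coprimeDiscrepancy p f := by
  simp only [coprimeDiscrepancy, ← Finset.mul_sum]
  ring

lemma coprimeDiscrepancy_sum (p : ℕ) [NeZero p] {ι : Type*} (s : Finset ι)
    (f : ι → ZMod p → ℂ) :
    coprimeDiscrepancy p (fun x => ∑ i ∈ s, f i x) = ∑ i ∈ s, coprimeDiscrepancy p (f i) := by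
  simp only [coprimeDiscrepancy, Finset.sum_sub_distrib, ← Finset.mul_sum]
  rw [Finset.sum_comm, Finset.sum_comm (s := Finset.univ)]

lemma norm_coprimeDiscrepancy_mulChar_le {p : ℕ} [Fact p.Prime] (hp2 : p ≠ 2)
    (χ : MulChar (ZMod p) ℂ) :
    ‖coprimeDiscrepancy p χ‖ ≤
      2 ^ ((p - 1).primeFactors.card - 1) * (√p * Real.log p) := by
  have hpp : p.Prime := Fact.out
  have hn : p - 1 ≠ 0 := by have := hpp.two_le; omega
  have hn2 : 2 ∣ p - 1 := by
    obtain ⟨k, hk⟩ := hpp.odd_of_ne_two hp2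
    exact ⟨k, by omega⟩
  by_cases hχ : χ = 1
  · have h0 : coprimeDiscrepancy p χ = 0 := by
      have hA : ∑ m ∈ Finset.Ico 1 (1 + (p - 1)) with (p - 1).Coprime m, χ (m : ZMod p) =
          ((p - 1).totient : ℂ) := by
        rw [← Nat.filter_coprime_Ico_eq_totient (p - 1) 1, Finset.card_eq_sum_ones,
          Nat.cast_sum]
        refine Finset.sum_congr rfl fun m hm => ?_
        simp only [Finset.mem_filter, Finset.mem_Ico] at hm
        rw [hχ, MulChar.one_apply, Nat.cast_one]
        rw [isUnit_iff_ne_zero, Ne, ZMod.natCast_eq_zero_iff]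
        exact Nat.not_dvd_of_pos_of_lt (by omega) (by omega)
      have hn' : ((p - 1 : ℕ) : ℂ) ≠ 0 := by exact_mod_cast hn
      rw [coprimeDiscrepancy, hA, hχ, MulChar.sum_one_eq_card_units, ZMod.card_units]
      field_simp
      ring
    rw [h0, norm_zero]
    have : 0 ≤ Real.log p := Real.log_natCast_nonneg p
    positivity
  · rw [coprimeDiscrepancy, MulChar.sum_eq_zero_of_ne_one hχ, mul_zero, sub_zero]
    exact norm_sum_mulChar_coprime_le_s12 hp2 hχ hn hn2

open Classical in
/-- The indicator function of the set where the character `χ` does not take the value `1`. -/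
noncomputable def MulChar.neOneIndicator {p : ℕ} (χ : MulChar (ZMod p) ℂ) (x : ZMod p) : ℂ :=
  if χ x = 1 then 0 else 1

lemma MulChar.mul_neOneIndicator {p : ℕ} [Fact p.Prime] {χ : MulChar (ZMod p) ℂ} {l : ℕ}
    (hl : l ≠ 0) (hχ : χ ^ l = 1) (ξ : MulChar (ZMod p) ℂ) (x : ZMod p) :
    ξ x * χ.neOneIndicator x =
      (1 - 1 / (l : ℂ)) * ξ x -
        1 / (l : ℂ) * ∑ j ∈ Finset.range (l - 1), (ξ * χ ^ (j + 1)) x := by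
  have hl' : (l : ℂ) ≠ 0 := by exact_mod_cast hl
  by_cases hx : x = 0
  · simp only [hx, MulChar.map_zero]
    simp
  have hpow (j : ℕ) : (ξ * χ ^ j) x = ξ x * χ x ^ j := by
    have := MulChar.pow_apply_coe χ j (Units.mk0 x hx)
    rw [Units.val_mk0] at this
    rw [MulChar.mul_apply, this]
  have hroot : χ x ^ l = 1 := by
    have := hpow l
    rw [hχ, mul_one] at this
    have hξ : ξ x ≠ 0 := ((isUnit_iff_ne_zero.2 hx).map ξ).ne_zero
    exact mul_left_cancel₀ hξ (by rw [← this, mul_one])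
  have hsum : ∑ j ∈ Finset.range (l - 1), χ x ^ (j + 1) =
      ∑ j ∈ Finset.range l, χ x ^ j - 1 := by
    obtain ⟨k, rfl⟩ := Nat.exists_eq_succ_of_ne_zero hl
    rw [Finset.sum_range_succ' _ k]
    simp
  simp_rw [hpow]
  rw [← Finset.mul_sum, hsum, MulChar.neOneIndicator]
  split_ifs with h
  · simp only [h, one_pow, Finset.sum_const, Finset.card_range, nsmul_eq_mul]
    field_simp
    ring
  · rw [geom_sum_eq h, hroot]
    field_simp
    ring

lemma norm_coprimeDiscrepancy_mul_neOneIndicator_le {p : ℕ} [Fact p.Prime]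
    {χ : MulChar (ZMod p) ℂ} {l : ℕ} (hl : l ≠ 0) (hχ : χ ^ l = 1) {F : ZMod p → ℂ} {C : ℝ}
    (hF : ∀ ξ : MulChar (ZMod p) ℂ, ‖coprimeDiscrepancy p (fun x => ξ x * F x)‖ ≤ C)
    (ξ : MulChar (ZMod p) ℂ) :
    ‖coprimeDiscrepancy p (fun x => ξ x * (χ.neOneIndicator x * F x))‖ ≤
      2 * (1 - (l : ℝ)⁻¹) * C := by
  have hl1 : (1 : ℝ) ≤ l := by exact_mod_cast Nat.one_le_iff_ne_zero.2 hl
  have hexp : (fun x => ξ x * (χ.neOneIndicator x * F x)) = fun x =>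
      (1 - 1 / (l : ℂ)) * (ξ x * F x) -
        1 / (l : ℂ) * ∑ j ∈ Finset.range (l - 1), (ξ * χ ^ (j + 1)) x * F x := by
    funext x
    rw [← mul_assoc, MulChar.mul_neOneIndicator hl hχ, ← Finset.sum_mul]
    ring
  rw [hexp, coprimeDiscrepancy_sub, coprimeDiscrepancy_const_mul, coprimeDiscrepancy_const_mul,
    coprimeDiscrepancy_sum]
  refine (norm_sub_le _ _).trans ?_
  rw [norm_mul, norm_mul]
  have h1 : ‖(1 - 1 / (l : ℂ))‖ = 1 - (l : ℝ)⁻¹ := by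
    have : (1 - 1 / (l : ℂ)) = ((1 - (l : ℝ)⁻¹ : ℝ) : ℂ) := by push_cast; ring
    rw [this, Complex.norm_real, Real.norm_of_nonneg]
    have := inv_le_one_of_one_le₀ hl1
    linarith
  have h2 : ‖1 / (l : ℂ)‖ = (l : ℝ)⁻¹ := by simp
  have h3 : ‖∑ j ∈ Finset.range (l - 1),
      coprimeDiscrepancy p (fun x => (ξ * χ ^ (j + 1)) x * F x)‖ ≤ (l - 1) * C := by
    refine (norm_sum_le_of_le _ fun j _ => hF _).trans_eq ?_
    rw [Finset.sum_const, Finset.card_range, nsmul_eq_mul,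
      Nat.cast_sub (Nat.one_le_iff_ne_zero.2 hl), Nat.cast_one]
  rw [h1, h2]
  have hi : (0 : ℝ) ≤ 1 - (l : ℝ)⁻¹ := sub_nonneg.2 (inv_le_one_of_one_le₀ hl1)
  calc _ ≤ (1 - (l : ℝ)⁻¹) * C + (l : ℝ)⁻¹ * ((l - 1) * C) := by
        gcongr
        exact hF ξ
    _ = 2 * (1 - (l : ℝ)⁻¹) * C := by
        field_simp
        ring

lemma norm_coprimeDiscrepancy_prod_neOneIndicator_le {p : ℕ} [Fact p.Prime] (hp2 : p ≠ 2)
    (χ : ℕ → MulChar (ZMod p) ℂ) (S : Finset ℕ) (hS : ∀ l ∈ S, l ≠ 0 ∧ χ l ^ l = 1)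
    (ξ : MulChar (ZMod p) ℂ) :
    ‖coprimeDiscrepancy p (fun x => ξ x * ∏ l ∈ S, (χ l).neOneIndicator x)‖ ≤
      (∏ l ∈ S, 2 * (1 - (l : ℝ)⁻¹)) *
        (2 ^ ((p - 1).primeFactors.card - 1) * (√p * Real.log p)) := by
  induction S using Finset.induction_on generalizing ξ with
  | empty => simpa using norm_coprimeDiscrepancy_mulChar_le hp2 ξ
  | insert q S hq ih =>
    simp only [Finset.prod_insert hq]
    rw [mul_assoc]
    obtain ⟨h1, h2⟩ := hS q (Finset.mem_insert_self _ _)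
    exact norm_coprimeDiscrepancy_mul_neOneIndicator_le h1 h2
      (ih fun l hl => hS l (Finset.mem_insert_of_mem hl)) ξ

lemma MulChar.eq_one_of_apply_eq_one_of_isPrimitiveRootModP {p : ℕ} [Fact p.Prime]
    {χ : MulChar (ZMod p) ℂ} {g : ℤ} (hg : IsPrimitiveRootModP p g) (hχ : χ g = 1) : χ = 1 := by
  ext a
  obtain ⟨k, hk⟩ := hg a a.ne_zero
  rw [← hk, map_pow, hχ, one_pow, hk, MulChar.one_apply_coe]

/-- The residues detected as non-residues that are not primitive roots by characters `χ l` of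
order `l`, for `l` a prime factor of `p - 1`. -/
def qnrnpSet (p : ℕ) (χ : ℕ → MulChar (ZMod p) ℂ) : Set (ZMod p) :=
  {x | x ≠ 0 ∧ χ 2 x ≠ 1 ∧ ∃ l ∈ (p - 1).primeFactors, χ l x = 1}

lemma isQNRNP_of_mem_qnrnpSet {p : ℕ} [Fact p.Prime] {χ : ℕ → MulChar (ZMod p) ℂ}
    (hχ : ∀ l ∈ (p - 1).primeFactors, orderOf (χ l) = l) (h2 : orderOf (χ 2) = 2) {g : ℤ}
    (hg : (g : ZMod p) ∈ qnrnpSet p χ) : IsQNRNP p g := by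
  obtain ⟨hg0, hg2, l, hl, hgl⟩ := hg
  refine ⟨?_, fun hprim => ?_⟩
  · rintro ⟨x, hx⟩
    have hx' := (ZMod.intCast_eq_intCast_iff _ _ p).2 hx
    push_cast at hx'
    have hx0 : (x : ZMod p) ≠ 0 := by
      rintro h
      rw [h] at hx'
      exact hg0 (by rw [← hx']; simp)
    apply hg2
    have h2' : χ 2 ^ 2 = 1 := orderOf_dvd_iff_pow_eq_one.1 h2.dvd
    rw [← hx', map_pow]
    have := MulChar.pow_apply_coe (χ 2) 2 (Units.mk0 (x : ZMod p) hx0)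
    rw [Units.val_mk0] at this
    rw [← this, h2', ← Units.val_mk0 hx0, MulChar.one_apply_coe]
  · have h1 := MulChar.eq_one_of_apply_eq_one_of_isPrimitiveRootModP hprim hgl
    have := hχ l hl
    rw [h1, orderOf_one] at this
    exact (Nat.prime_of_mem_primeFactors hl).one_lt.ne this

lemma ncard_odd_not_coprime_le {p : ℕ} [Fact p.Prime] (hp2 : p ≠ 2)
    {χ : ℕ → MulChar (ZMod p) ℂ}
    (hχ : ∀ l ∈ (p - 1).primeFactors, orderOf (χ l) = l) (h2 : orderOf (χ 2) = 2) :
    Set.ncard {i : ℕ | 1 ≤ i ∧ i ≤ p - 1 ∧ Odd i ∧ 1 < Nat.gcd i (p - 1)} ≤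
      (qnrnpSet p χ).ncard := by
  have hpp : p.Prime := Fact.out
  obtain ⟨h, hh⟩ := hpp.odd_of_ne_two hp2
  obtain ⟨g, hgen⟩ := IsCyclic.exists_generator (α := (ZMod p)ˣ)
  have hg := orderOf_eq_card_of_forall_mem_zpowers hgen
  rw [Nat.card_eq_fintype_card, ZMod.card_units] at hg
  have hprim : IsPrimitiveRootModP p ((g : ZMod p).val : ℤ) := by
    intro a ha
    have hmem : Units.mk0 a ha ∈ Submonoid.powers g :=
      mem_powers_iff_mem_zpowers.2 (hgen _)
    obtain ⟨k, hk⟩ := hmem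
    refine ⟨k, ?_⟩
    have := congrArg Units.val hk
    simpa using this
  have hg2 : χ 2 g ≠ 1 := by
    intro h1
    have := MulChar.eq_one_of_apply_eq_one_of_isPrimitiveRootModP (χ := χ 2) hprim
      (by simpa using h1)
    rw [this, orderOf_one] at h2
    omega
  have hgneg : χ 2 g = -1 := by
    have h3 : χ 2 ^ 2 = 1 := orderOf_dvd_iff_pow_eq_one.1 h2.dvd
    have := MulChar.pow_apply_coe (χ 2) 2 g
    rw [h3, MulChar.one_apply_coe] at this
    exact (mul_self_eq_one_iff.1 ((sq _).symm.trans this.symm)).resolve_left hg2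
  refine Set.ncard_le_ncard_of_injOn (fun i => (g : ZMod p) ^ i) ?_ ?_ (Set.toFinite _)
  · rintro i ⟨_, _, hodd, hgcd⟩
    refine ⟨pow_ne_zero _ g.ne_zero, ?_, ?_⟩
    · rw [map_pow, hgneg, hodd.neg_one_pow]
      norm_num
    · obtain ⟨l, hlp, hl⟩ := Nat.exists_prime_and_dvd hgcd.ne'
      have hlm : l ∈ (p - 1).primeFactors :=
        Nat.mem_primeFactors.2 ⟨hlp, hl.trans (Nat.gcd_dvd_right _ _),
          by have := hpp.two_le; omega⟩
      refine ⟨l, hlm, ?_⟩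
      have h3 : χ l ^ i = 1 := orderOf_dvd_iff_pow_eq_one.1
        ((hχ l hlm).symm ▸ hl.trans (Nat.gcd_dvd_left _ _))
      rw [map_pow, ← MulChar.pow_apply_coe, h3, MulChar.one_apply_coe]
  · rintro i ⟨_, hi, hio, _⟩ j ⟨_, hj, hjo, _⟩ hij
    obtain ⟨a, ha⟩ := hio
    obtain ⟨b, hb⟩ := hjo
    refine pow_injOn_Iio_orderOf (x := g) ?_ ?_ (Units.ext (by simpa using hij))
    · rw [Set.mem_Iio]; omega
    · rw [Set.mem_Iio]; omega

lemma neOneIndicator_sub_prod {p : ℕ} [Fact p.Prime] {χ : ℕ → MulChar (ZMod p) ℂ}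
    (h2 : 2 ∈ (p - 1).primeFactors) (x : ZMod p) [Decidable (x ∈ qnrnpSet p χ)] :
    (1 : MulChar (ZMod p) ℂ) x * (∏ l ∈ {2}, (χ l).neOneIndicator x) -
      (1 : MulChar (ZMod p) ℂ) x * ∏ l ∈ (p - 1).primeFactors, (χ l).neOneIndicator x =
      if x ∈ qnrnpSet p χ then 1 else 0 := by
  rw [Finset.prod_singleton]
  by_cases hx : x = 0
  · rw [if_neg (fun h => h.1 hx), hx, MulChar.map_zero]
    ring
  rw [MulChar.one_apply (isUnit_iff_ne_zero.2 hx), one_mul, one_mul]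
  by_cases hx2 : χ 2 x = 1
  · have h0 : (χ 2).neOneIndicator x = 0 := if_pos hx2
    rw [if_neg (fun h => h.2.1 hx2), Finset.prod_eq_zero h2 h0, h0, sub_zero]
  · have h1 : (χ 2).neOneIndicator x = 1 := if_neg hx2
    rw [h1]
    by_cases hex : ∃ l ∈ (p - 1).primeFactors, χ l x = 1
    · obtain ⟨l, hl, hlx⟩ := hex
      have h0 : (χ l).neOneIndicator x = 0 := if_pos hlx
      rw [if_pos ⟨hx, hx2, l, hl, hlx⟩, Finset.prod_eq_zero hl h0, sub_zero]
    · rw [if_neg (fun h => hex h.2.2), Finset.prod_eq_one, sub_self]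
      intro l hl
      exact if_neg fun h => hex ⟨l, hl, h⟩

theorem stmt12 (p q : ℕ) (hp : p.Prime) (hp2 : p ≠ 2) (hq : 0 < q) (hdvd : q ∣ p - 1)
    (hβ₀ : ((Set.ncard {i : ℕ | 1 ≤ i ∧ i ≤ p - 1 ∧ Odd i ∧ 1 < Nat.gcd i (p - 1)} : ℕ) : ℝ)
      > 4 ^ (p - 1).primeFactors.card * Real.sqrt p * Real.log p) :
    ∃ m : ℕ, 1 ≤ m ∧ m ≤ p - 1 ∧ Nat.gcd m ((p - 1) / q) = 1 ∧ IsQNRNP p (m : ℤ) := by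
  classical
  have : Fact p.Prime := ⟨hp⟩
  have hn : p - 1 ≠ 0 := by have := hp.two_le; omega
  have h2 : 2 ∈ (p - 1).primeFactors := by
    obtain ⟨k, hk⟩ := hp.odd_of_ne_two hp2
    exact Nat.mem_primeFactors.2 ⟨Nat.prime_two, ⟨k, by omega⟩, hn⟩
  have hex (l : ℕ) : ∃ χ : MulChar (ZMod p) ℂ, l ∈ (p - 1).primeFactors → orderOf χ = l := by
    by_cases hl : l ∈ (p - 1).primeFactors
    · obtain ⟨χ, hχ⟩ := MulChar.exists_mulChar_orderOf (ZMod p) (R := ℂ) (n := l)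
        (by rw [ZMod.card]; exact Nat.dvd_of_mem_primeFactors hl)
        (Complex.isPrimitiveRoot_exp l (Nat.prime_of_mem_primeFactors hl).ne_zero)
      exact ⟨χ, fun _ => hχ⟩
    · exact ⟨1, fun h => absurd h hl⟩
  choose χ hχ using hex
  have hpow (l : ℕ) (hl : l ∈ (p - 1).primeFactors) : l ≠ 0 ∧ χ l ^ l = 1 :=
    ⟨(Nat.prime_of_mem_primeFactors hl).ne_zero,
      orderOf_dvd_iff_pow_eq_one.1 (hχ l hl).dvd⟩
  by_contra hcon
  push Not at hcon
  have hnone (m : ℕ) (hm : m ∈ Finset.Ico 1 (1 + (p - 1)) ∧ (p - 1).Coprime m) :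
      (m : ZMod p) ∉ qnrnpSet p χ := by
    intro hmem
    have hm1 := Finset.mem_Ico.1 hm.1
    refine hcon m hm1.1 (by omega) ?_ (isQNRNP_of_mem_qnrnpSet hχ (hχ 2 h2) (by simpa using hmem))
    exact Nat.Coprime.coprime_dvd_right (Nat.div_dvd_of_dvd hdvd) hm.2.symm
  set ω := (p - 1).primeFactors.card with hω
  have hω1 : 1 ≤ ω := Finset.card_pos.2 ⟨2, h2⟩
  set E : ℝ := √p * Real.log p with hE
  have hE0 : 0 ≤ E := mul_nonneg (Real.sqrt_nonneg _) (Real.log_natCast_nonneg p)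
  set y : ℝ := ∏ l ∈ (p - 1).primeFactors, 2 * (1 - (l : ℝ)⁻¹) with hy
  set θ : ℝ := ∏ l ∈ (p - 1).primeFactors, (1 - (l : ℝ)⁻¹) with hθ
  have hinv (l : ℕ) (hl : l ∈ (p - 1).primeFactors) : (l : ℝ)⁻¹ ≤ 2⁻¹ := by
    have : (2 : ℝ) ≤ l := by exact_mod_cast (Nat.prime_of_mem_primeFactors hl).two_le
    gcongr
  have hyθ : y = 2 ^ ω * θ := by rw [hy, Finset.prod_mul_distrib, Finset.prod_const]
  have hy1 : 1 ≤ y := by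
    refine Finset.prod_induction _ (fun z : ℝ => 1 ≤ z) (fun a b => one_le_mul_of_one_le_of_one_le)
      le_rfl fun l hl => ?_
    have := hinv l hl
    linarith
  have hθ0 : 0 < θ := Finset.prod_pos fun l hl => by
    have := hinv l hl
    linarith
  have htot : ((p - 1).totient : ℝ) = ((p - 1 : ℕ) : ℝ) * θ := by
    have := congrArg (fun z : ℚ => (z : ℝ)) (Nat.totient_eq_mul_prod_factors (p - 1))
    rw [hθ]
    push_cast at this ⊢
    exact this
  have hratio : ((p - 1).totient : ℂ) / ((p - 1 : ℕ) : ℂ) = (θ : ℂ) := by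
    rw [div_eq_iff (by exact_mod_cast hn), mul_comm]
    exact_mod_cast htot
  have hdisc : coprimeDiscrepancy p (fun x => if x ∈ qnrnpSet p χ then 1 else 0) =
      -((θ * (qnrnpSet p χ).ncard : ℝ) : ℂ) := by
    rw [coprimeDiscrepancy, hratio, Finset.sum_eq_zero, Finset.sum_boole,
      Set.ncard_eq_toFinset_card']
    · push_cast
      rw [zero_sub, Set.filter_mem_univ_eq_toFinset]
    · intro m hm
      exact if_neg (hnone m (Finset.mem_filter.1 hm))
  have hupper : θ * (qnrnpSet p χ).ncard ≤ (1 + y) * (2 ^ (ω - 1) * E) := by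
    have h1 := norm_coprimeDiscrepancy_prod_neOneIndicator_le hp2 χ {2}
      (fun l hl => hpow l (Finset.mem_singleton.1 hl ▸ h2)) 1
    have h3 := norm_coprimeDiscrepancy_prod_neOneIndicator_le hp2 χ _ hpow 1
    rw [Finset.prod_singleton] at h1
    have h4 : ‖coprimeDiscrepancy p (fun x => if x ∈ qnrnpSet p χ then 1 else 0)‖ =
        θ * (qnrnpSet p χ).ncard := by
      rw [hdisc, norm_neg, Complex.norm_real, Real.norm_of_nonneg (by positivity)]
    rw [← h4]
    simp_rw [← neOneIndicator_sub_prod h2]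
    rw [coprimeDiscrepancy_sub]
    refine (norm_sub_le _ _).trans ((add_le_add h1 h3).trans_eq ?_)
    push_cast
    ring
  have hcard : (4 : ℝ) ^ ω * E < (qnrnpSet p χ).ncard := by
    have h1 : (Set.ncard {i : ℕ | 1 ≤ i ∧ i ≤ p - 1 ∧ Odd i ∧ 1 < Nat.gcd i (p - 1)} : ℝ) ≤
        (qnrnpSet p χ).ncard := by
      exact_mod_cast ncard_odd_not_coprime_le hp2 hχ (hχ 2 h2)
    rw [hE, ← mul_assoc]
    exact hβ₀.trans_le h1
  have hK : (0 : ℝ) ≤ 2 ^ (ω - 1) * E := by positivity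
  have h2ω : (2 : ℝ) ^ ω = 2 * 2 ^ (ω - 1) := by
    rw [← pow_succ', Nat.sub_add_cancel hω1]
  have hlower : θ * (4 ^ ω * E) = 2 * y * (2 ^ (ω - 1) * E) := by
    have h4 : (4 : ℝ) ^ ω = 2 ^ ω * 2 ^ ω := by rw [← mul_pow]; norm_num
    rw [hyθ, h4]
    nth_rewrite 2 [h2ω]
    ring
  have hstrict := mul_lt_mul_of_pos_left hcard hθ0
  nlinarith [mul_nonneg (sub_nonneg.2 hy1) hK]
end

section
/- For every prime p ≥ 5, one has 4^{ω(p−1)} ≤ p^{(log 6.83)/(log log p)}. -/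
open Finset in
/-- The product of the first `#s` primes is at most the product of any finite set `s` of primes. -/
theorem prod_nth_prime_le_prod (s : Finset ℕ) (hs : ∀ q ∈ s, q.Prime) :
    ∏ i ∈ range #s, Nat.nth Nat.Prime i ≤ ∏ q ∈ s, q := by
  induction s using Finset.induction_on_max with
  | empty => simp
  | insert m s hm ih =>
    have hms : m ∉ s := fun h => lt_irrefl _ (hm m h)
    rw [card_insert_of_notMem hms, prod_range_succ, prod_insert hms, mul_comm]
    refine Nat.mul_le_mul ?_ (ih fun q hq => hs q (mem_insert_of_mem hq))
    have hcard : #s ≤ Nat.count Nat.Prime m := by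
      rw [Nat.count_eq_card_filter_range]
      exact card_le_card fun q hq =>
        mem_filter.2 ⟨mem_range.2 (hm q hq), hs q (mem_insert_of_mem hq)⟩
    calc Nat.nth Nat.Prime #s ≤ Nat.nth Nat.Prime (Nat.count Nat.Prime m) :=
          Nat.nth_monotone Nat.infinite_setOfPred_prime hcard
      _ = m := Nat.nth_count (hs m (mem_insert_self _ _))

open Finset in
/-- Among any six consecutive integers greater than `3` at most two are prime. -/
theorem count_prime_add_six_le (n : ℕ) (hn : 3 < n) :
    Nat.count Nat.Prime (n + 6) ≤ Nat.count Nat.Prime n + 2 := by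
  rw [Nat.count_add, Nat.add_le_add_iff_left, Nat.count_eq_card_filter_range]
  have h2 : (2 : ℕ) = #{x ∈ Ico n (n + 6) | Nat.Coprime 6 x} := by
    rw [Nat.filter_coprime_Ico_eq_totient]; decide
  rw [h2]
  refine card_le_card_of_injOn (fun i => n + i) (fun i hi => ?_) (fun a _ b _ h => by simpa using h)
  simp only [coe_filter, mem_range, Set.mem_ofPred_eq] at hi
  simp only [coe_filter, mem_Ico, Set.mem_ofPred_eq]
  refine ⟨⟨by omega, by omega⟩, ?_⟩
  rw [show 6 = 2 * 3 from rfl, Nat.coprime_mul_iff_left, Nat.coprime_primes Nat.prime_two hi.2,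
    Nat.coprime_primes Nat.prime_three hi.2]
  omega

theorem count_prime_le (n : ℕ) (hn : 31 ≤ n) : 70 * (Nat.count Nat.Prime n + 1) ≤ 27 * n := by
  induction n using Nat.strong_induction_on with
  | _ n ih =>
    by_cases h : n < 37
    · have h31 : Nat.count Nat.Prime 37 = 11 := by decide +kernel
      have hc : Nat.count Nat.Prime 31 = 10 := by decide +kernel
      rcases hn.eq_or_lt with rfl | hn
      · omega
      · have := Nat.count_monotone Nat.Prime h.le
        rcases Nat.lt_or_ge n 32 with h' | h'
        · omega
        · omega
    · obtain ⟨m, rfl⟩ : ∃ m, n = m + 6 := ⟨n - 6, by omega⟩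
      have := ih m (by omega) (by omega)
      have := count_prime_add_six_le m (by omega)
      omega

theorem nth_prime_ge (i : ℕ) (hi : 10 ≤ i) : 70 * (i + 1) ≤ 27 * Nat.nth Nat.Prime i := by
  have hc : Nat.count Nat.Prime (Nat.nth Nat.Prime i) = i :=
    Nat.count_nth_of_infinite Nat.infinite_setOfPred_prime i
  have h31 : Nat.nth Nat.Prime 10 = 31 := by
    have h := Nat.nth_count (p := Nat.Prime) (n := 31) (by norm_num)
    rwa [show Nat.count Nat.Prime 31 = 10 by decide +kernel] at h
  have := count_prime_le _ (h31 ▸ Nat.nth_monotone Nat.infinite_setOfPred_prime hi)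
  rwa [hc] at this

/-- The product of the first `k` primes. -/
theorem prod_nth_prime_eq :
    ∀ k ≤ 10, ∏ i ∈ Finset.range k, Nat.nth Nat.Prime i =
      ([2, 3, 5, 7, 11, 13, 17, 19, 23, 29].take k).prod := by
  have key (q c : ℕ) (hq : q.Prime) (hc : Nat.count Nat.Prime q = c) : Nat.nth Nat.Prime c = q :=
    hc ▸ Nat.nth_count hq
  have h0 := key 2 0 (by norm_num) (by decide +kernel)
  have h1 := key 3 1 (by norm_num) (by decide +kernel)
  have h2 := key 5 2 (by norm_num) (by decide +kernel)
  have h3 := key 7 3 (by norm_num) (by decide +kernel)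
  have h4 := key 11 4 (by norm_num) (by decide +kernel)
  have h5 := key 13 5 (by norm_num) (by decide +kernel)
  have h6 := key 17 6 (by norm_num) (by decide +kernel)
  have h7 := key 19 7 (by norm_num) (by decide +kernel)
  have h8 := key 23 8 (by norm_num) (by decide +kernel)
  have h9 := key 29 9 (by norm_num) (by decide +kernel)
  intro k hk
  interval_cases k <;>
    simp [Finset.prod_range_succ, h0, h1, h2, h3, h4, h5, h6, h7, h8, h9]

/-- The tangent bound for `log` at `k * v`. -/
theorem log_le_tangent {k v L : ℝ} (hk : 0 < k) (hv : 0 < v) (hL : 0 < L) :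
    k * Real.log L ≤ k * (Real.log (k * v) - 1) + L / v := by
  have h := Real.log_le_sub_one_of_pos (show 0 < L / (k * v) by positivity)
  rw [Real.log_div hL.ne' (by positivity)] at h
  have h' := mul_le_mul_of_nonneg_left h hk.le
  have : k * (L / (k * v) - 1) = L / v - k := by field_simp
  linarith

/-- Comparison of logarithms from a comparison of integer powers. -/
theorem mul_log_le_of_pow_le {k P : ℕ} {x : ℝ} (hx : 0 < x) (hP : 0 < P) (a b : ℕ)
    (h : x ^ (a * k) ≤ 2.718 ^ (a * k) * (P : ℝ) ^ b) :
    a * (k * (Real.log x - 1)) ≤ b * Real.log P := by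
  have he : Real.log 2.718 ≤ 1 := by
    rw [Real.log_le_iff_le_exp (by norm_num)]
    linarith [Real.exp_one_gt_d9]
  have hP' : (0 : ℝ) < P := by exact_mod_cast hP
  have := Real.log_le_log (by positivity) h
  rw [Real.log_mul (by positivity) (by positivity), Real.log_pow, Real.log_pow, Real.log_pow] at this
  push_cast at this
  have h2 := mul_le_mul_of_nonneg_left he (show (0 : ℝ) ≤ a * k by positivity)
  linarith

theorem log_prod_nth_prime_ge (k : ℕ) (hk : 10 ≤ k) :
    k * (Real.log (k * (70 / 27)) - 1) ≤
      Real.log (∏ i ∈ Finset.range k, Nat.nth Nat.Prime i : ℕ) := by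
  induction k, hk using Nat.le_induction with
  | base =>
    rw [prod_nth_prime_eq 10 le_rfl]
    have := mul_log_le_of_pow_le (k := 10)
      (P := ([2, 3, 5, 7, 11, 13, 17, 19, 23, 29].take 10).prod) (x := (10 : ℕ) * (70 / 27))
      (by norm_num) (by norm_num) 1 1 (by norm_num)
    simpa using this
  | succ k hk ih =>
    have hk0 : (0 : ℝ) < k := by exact_mod_cast (by omega : 0 < k)
    have hq : ((k + 1 : ℕ) : ℝ) * (70 / 27) ≤ (Nat.nth Nat.Prime k : ℕ) := by
      have : (70 : ℝ) * (k + 1) ≤ 27 * Nat.nth Nat.Prime k := by exact_mod_cast nth_prime_ge k hk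
      push_cast
      linarith
    have hlog := Real.log_le_log (by positivity) hq
    have hprod : (∏ i ∈ Finset.range k, Nat.nth Nat.Prime i : ℕ) ≠ 0 :=
      Finset.prod_ne_zero_iff.2 fun i _ => (Nat.prime_nth_prime i).ne_zero
    rw [Finset.prod_range_succ, Nat.cast_mul,
      Real.log_mul (Nat.cast_ne_zero.2 hprod) (Nat.cast_ne_zero.2 (Nat.prime_nth_prime k).ne_zero)]
    have e : ((k + 1 : ℕ) : ℝ) * (70 / 27) / (70 / 27) = (k + 1 : ℕ) := by field_simp
    have ht := log_le_tangent hk0 (show (0 : ℝ) < 70 / 27 by norm_num)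
      (show (0 : ℝ) < (k + 1 : ℕ) * (70 / 27) by positivity)
    rw [e] at ht
    have hcast : ((k + 1 : ℕ) : ℝ) = k + 1 := by push_cast; rfl
    calc ((k + 1 : ℕ) : ℝ) * (Real.log ((k + 1 : ℕ) * (70 / 27)) - 1)
        = k * Real.log ((k + 1 : ℕ) * (70 / 27)) - (k + 1 : ℕ) +
            Real.log ((k + 1 : ℕ) * (70 / 27)) := by
          linear_combination (Real.log ((k + 1 : ℕ) * (70 / 27))) * hcast
      _ ≤ _ := by linarith

set_option exponentiation.threshold 400 in
/-- If `L` is at least the logarithm of the product of the first `k` primes, then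
`k ≤ (97 / 70) * L / log L`. -/
theorem mul_log_le_of_log_prod_nth_prime_le (k : ℕ) (L : ℝ) (hL : 0 < L)
    (h : Real.log (∏ i ∈ Finset.range k, Nat.nth Nat.Prime i : ℕ) ≤ L) :
    k * Real.log L ≤ 97 / 70 * L := by
  rcases Nat.eq_zero_or_pos k with rfl | hk
  · simp; positivity
  have hk0 : (0 : ℝ) < k := by exact_mod_cast hk
  rcases Nat.lt_or_ge k 10 with hk10 | hk10
  · have ht := log_le_tangent hk0 (show (0 : ℝ) < 17 / 8 by norm_num) hL
    have hs : 35 * (k * (Real.log (k * (17 / 8)) - 1)) ≤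
        32 * Real.log (∏ i ∈ Finset.range k, Nat.nth Nat.Prime i : ℕ) := by
      rw [prod_nth_prime_eq k hk10.le]
      have hpow : ((k : ℝ) * (17 / 8)) ^ (35 * k) ≤ 2.718 ^ (35 * k) *
          (([2, 3, 5, 7, 11, 13, 17, 19, 23, 29].take k).prod : ℕ) ^ 32 := by
        interval_cases k <;> norm_num
      have hP : 0 < ([2, 3, 5, 7, 11, 13, 17, 19, 23, 29].take k).prod := by
        interval_cases k <;> norm_num
      exact_mod_cast mul_log_le_of_pow_le (by positivity) hP 35 32 hpow
    linarith
  · have ht := log_le_tangent hk0 (show (0 : ℝ) < 70 / 27 by norm_num) hL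
    linarith [log_prod_nth_prime_ge k hk10]

theorem stmt15 (p : ℕ) (hp : p.Prime) (h5 : 5 ≤ p) :
    (4 : ℝ) ^ (p - 1).primeFactors.card
      ≤ (p : ℝ) ^ (Real.log 6.83 / Real.log (Real.log p)) := by
  have h5' : (5 : ℝ) ≤ p := by exact_mod_cast h5
  have hp0 : (0 : ℝ) < p := by linarith
  have hL1 : 1 < Real.log p := by
    rw [Real.lt_log_iff_exp_lt hp0]
    linarith [Real.exp_one_lt_d9]
  have hLL : 0 < Real.log (Real.log p) := Real.log_pos hL1
  have hprod : ∏ i ∈ Finset.range (p - 1).primeFactors.card, Nat.nth Nat.Prime i ≤ p :=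
    (prod_nth_prime_le_prod _ fun q hq => Nat.prime_of_mem_primeFactors hq).trans <|
      (Nat.le_of_dvd (by omega) (Nat.prod_primeFactors_dvd (p - 1))).trans (Nat.sub_le _ _)
  have hpos : 0 < ∏ i ∈ Finset.range (p - 1).primeFactors.card, Nat.nth Nat.Prime i :=
    Finset.prod_pos fun i _ => (Nat.prime_nth_prime i).pos
  have hmain := mul_log_le_of_log_prod_nth_prime_le _ (Real.log p) (by linarith)
    (Real.log_le_log (by exact_mod_cast hpos) (by exact_mod_cast hprod))
  have hc : 97 * Real.log 4 ≤ 70 * Real.log 6.83 := by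
    have := Real.log_le_log (by norm_num) (show (4 : ℝ) ^ 97 ≤ 6.83 ^ 70 by norm_num)
    simpa only [Real.log_pow, Nat.cast_ofNat] using this
  have h4 : 0 < Real.log 4 := Real.log_pos (by norm_num)
  rw [← Real.log_le_log_iff (by positivity) (by positivity), Real.log_pow, Real.log_rpow hp0,
    div_mul_eq_mul_div, le_div_iff₀ hLL]
  have h1 := mul_le_mul_of_nonneg_right hmain h4.le
  have h2 := mul_le_mul_of_nonneg_right hc (show 0 ≤ Real.log p by linarith)
  linarith
end
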